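/- arXiv:1701.04365 — 3 statements merged into one kernel-verified Lean document; each statement's English description precedes it below -/
import Mathlib

section
/- There exist positive constants c, C', C and r_0 such that the following holds for every function f : ℝ → ℝ, every integer n ≥ 1, all reals m > 0, ε > 0, Γ ≥ 1 and every ℓ > 0 dividing m. If S(n, m, ε, Γ) holds (for Q_n, q_n, f), and there exist real numbers r and λ ≥ 1 with r_0 ≤ r ≤ c n, m ≥ ℓ ≥ C' r, and λ m ≤ √(r n), then S(n, ℓ, ε', Γ') holds for every ε' ≥ ε + Γ η and every Γ' ≥ Γ (1 + η), where η = C·(e^{−c λ²} + λ m/√(r n) + r/ℓ + (n/ℓ) e^{−c n/r}). -/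
open MeasureTheory ProbabilityTheory

/-- Binary convolution of laws on `ℤ` (the law of the sum of independent variables). -/
noncomputable def mconvZ (μ ν : Measure ℤ) : Measure ℤ :=
  μ.bind (fun x => ν.map (fun y => x + y))

/-- `μ n` is the law of `Q_n`, the number of key comparisons used by QuickSort on `n` keys. -/
def IsQuicksortLaw (μ : ℕ → Measure ℤ) : Prop :=
  (∀ n, IsProbabilityMeasure (μ n)) ∧
  μ 0 = Measure.dirac 0 ∧ μ 1 = Measure.dirac 0 ∧
  ∀ n : ℕ, 2 ≤ n →
    μ n = (n : ENNReal)⁻¹ •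
      ∑ u ∈ Finset.Icc 1 n,
        (mconvZ (μ (u - 1)) (μ (n - u))).map (fun x => x + ((n : ℤ) - 1))

/-- The mean `q_n = E Q_n` of a law on `ℤ`. -/
noncomputable def meanZ (ν : Measure ℤ) : ℝ := ∫ k, (k : ℝ) ∂ν

/-- The smoothness statement `S(n, m, ε, Γ)` for the law `μn` of `Q_n` (with mean `qn`)
and density `f`:  (i) every half-open interval `I` of length `m` containing `q_n + n x`
has `|P(Q_n ∈ I) − (m/n) f(x)| ≤ ε m/n`;  (ii) every half-open interval of length `m` has
`P(Q_n ∈ I) ≤ Γ m/n`. -/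
def Sprop (μn : Measure ℤ) (qn : ℝ) (n : ℕ) (f : ℝ → ℝ) (m ε Γ : ℝ) : Prop :=
  (∀ a x : ℝ, qn + (n : ℝ) * x ∈ Set.Ioc a (a + m) →
    |(μn {k : ℤ | (k : ℝ) ∈ Set.Ioc a (a + m)}).toReal - (m / n) * f x| ≤ ε * m / n) ∧
  (∀ a : ℝ, (μn {k : ℤ | (k : ℝ) ∈ Set.Ioc a (a + m)}).toReal ≤ Γ * m / n)

/-- The expectation of `f (∑ i, D i * ξ i)` for independent fair signs `ξ i`, where `D` runs
through the list. -/
noncomputable def coinE : List ℝ → (ℝ → ℝ) → ℝ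
  | [], f => f 0
  | D :: L, f => (coinE L (fun s => f (s - D)) + coinE L (fun s => f (s + D))) / 2

lemma coinE_add (L : List ℝ) (f g : ℝ → ℝ) :
    coinE L (fun s => f s + g s) = coinE L f + coinE L g := by
  induction L generalizing f g with
  | nil => rfl
  | cons D L ih => simp only [coinE, ih]; ring

lemma coinE_const_mul (L : List ℝ) (c : ℝ) (f : ℝ → ℝ) :
    coinE L (fun s => c * f s) = c * coinE L f := by
  induction L generalizing f with
  | nil => rfl
  | cons D L ih => simp only [coinE, ih]; ring

lemma coinE_const (L : List ℝ) (c : ℝ) : coinE L (fun _ => c) = c := by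
  induction L with
  | nil => rfl
  | cons D L ih => simp only [coinE, ih]; ring

lemma coinE_mono (L : List ℝ) {f g : ℝ → ℝ} (h : ∀ s, f s ≤ g s) : coinE L f ≤ coinE L g := by
  induction L generalizing f g with
  | nil => exact h 0
  | cons D L ih =>
    simp only [coinE]
    linarith [ih (fun s => h (s - D)), ih (fun s => h (s + D))]

lemma coinE_sub (L : List ℝ) (f g : ℝ → ℝ) :
    coinE L (fun s => f s - g s) = coinE L f - coinE L g := by
  induction L generalizing f g with
  | nil => rfl
  | cons D L ih => simp only [coinE, ih]; ring

lemma coinE_nonneg (L : List ℝ) {f : ℝ → ℝ} (h : ∀ s, 0 ≤ f s) : 0 ≤ coinE L f := by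
  simpa [coinE_const] using coinE_mono L h

lemma abs_coinE_le (L : List ℝ) {f g : ℝ → ℝ} (h : ∀ s, |f s| ≤ g s) : |coinE L f| ≤ coinE L g := by
  rw [abs_le]
  constructor
  · have := coinE_mono L (f := fun s => (-1) * g s) (g := f) fun s => by linarith [(abs_le.1 (h s)).1]
    rw [coinE_const_mul] at this
    linarith
  · exact coinE_mono L fun s => (abs_le.1 (h s)).2

lemma coinE_append (L₁ L₂ : List ℝ) (f : ℝ → ℝ) :
    coinE (L₁ ++ L₂) f = coinE L₁ (fun s => coinE L₂ (fun t => f (s + t))) := by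
  induction L₁ generalizing f with
  | nil => simp [coinE]
  | cons D L ih =>
    simp only [List.cons_append, coinE, ih]
    simp only [add_sub_right_comm, add_right_comm]

lemma coinE_comm (L₁ L₂ : List ℝ) (f : ℝ → ℝ → ℝ) :
    coinE L₁ (fun s => coinE L₂ (fun t => f s t)) =
      coinE L₂ (fun t => coinE L₁ (fun s => f s t)) := by
  induction L₁ generalizing f with
  | nil => rfl
  | cons D L ih =>
    have h : (fun t => coinE (D :: L) (fun s => f s t)) = fun t =>
        (1 / 2) * (coinE L (fun s => f (s - D) t) + coinE L (fun s => f (s + D) t)) := by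
      funext t; simp only [coinE]; ring
    rw [h, coinE_const_mul, coinE_add, ← ih, ← ih]
    simp only [coinE]; ring

lemma coinE_neg (L : List ℝ) (f : ℝ → ℝ) : coinE L (fun s => f (-s)) = coinE L f := by
  induction L generalizing f with
  | nil => simp [coinE]
  | cons D L ih =>
    simp only [coinE]
    rw [← ih (fun s => f (s - D)), ← ih (fun s => f (s + D)), add_comm]
    congr 4 <;> funext s <;> congr 1 <;> ring

lemma coinE_add_sq (L : List ℝ) (x : ℝ) :
    coinE L (fun s => (x + s) ^ 2) = x ^ 2 + (L.map (· ^ 2)).sum := by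
  induction L generalizing x with
  | nil => simp [coinE]
  | cons D L ih =>
    have h1 : (fun s => (x + (s - D)) ^ 2) = fun s => ((x - D) + s) ^ 2 := by funext s; ring
    have h2 : (fun s => (x + (s + D)) ^ 2) = fun s => ((x + D) + s) ^ 2 := by funext s; ring
    simp only [coinE, h1, h2, ih, List.map_cons, List.sum_cons]
    ring

lemma coinE_sq (L : List ℝ) : coinE L (fun s => s ^ 2) = (L.map (· ^ 2)).sum := by
  simpa using coinE_add_sq L 0

/-- Explicit form of `coinE` as an average over sets of indices of positive signs. -/
lemma coinE_map_range (D : ℕ → ℝ) (N : ℕ) (f : ℝ → ℝ) :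
    coinE ((List.range N).map D) f = (∑ A ∈ (Finset.range N).powerset,
      f (∑ i ∈ Finset.range N, if i ∈ A then D i else -D i)) / 2 ^ N := by
  induction N generalizing f with
  | zero => simp [coinE]
  | succ N ih =>
    rw [List.range_succ, List.map_append, coinE_append, Finset.range_add_one,
      Finset.sum_powerset_insert Finset.notMem_range_self]
    have key : ∀ A ∈ (Finset.range N).powerset,
        (∑ i ∈ insert N (Finset.range N), (if i ∈ A then D i else -D i)) =
          (∑ i ∈ Finset.range N, if i ∈ A then D i else -D i) - D N ∧
        (∑ i ∈ insert N (Finset.range N), (if i ∈ insert N A then D i else -D i)) =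
          (∑ i ∈ Finset.range N, if i ∈ A then D i else -D i) + D N := by
      intro A hA
      have hN : N ∉ A := fun h => by simpa using Finset.mem_powerset.1 hA h
      constructor
      · rw [Finset.sum_insert Finset.notMem_range_self, if_neg hN]; ring
      · rw [Finset.sum_insert Finset.notMem_range_self, if_pos (Finset.mem_insert_self _ _),
          add_comm]
        congr 1
        refine Finset.sum_congr rfl fun i hi => ?_
        have : i ≠ N := (Finset.mem_range.1 hi).ne
        simp [this]
    rw [Finset.sum_congr rfl fun A hA => congrArg f (key A hA).1,
      Finset.sum_congr rfl fun A hA => congrArg f (key A hA).2, ih]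
    simp only [List.map_cons, List.map_nil, coinE, zero_sub, zero_add, ← sub_eq_add_neg]
    rw [← Finset.sum_add_distrib, ← Finset.sum_div, pow_succ]
    field_simp

lemma centralBinom_sq_le (k : ℕ) : (2 * k + 1) * k.centralBinom ^ 2 ≤ 16 ^ k := by
  induction k with
  | zero => simp
  | succ k ih =>
    have h := Nat.succ_mul_centralBinom_succ k
    refine le_of_mul_le_mul_left (a := (k + 1) ^ 2) ?_ (by positivity)
    calc (k + 1) ^ 2 * ((2 * (k + 1) + 1) * (k + 1).centralBinom ^ 2)
        = (2 * k + 3) * ((k + 1) * (k + 1).centralBinom) ^ 2 := by ring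
      _ = 4 * ((2 * k + 3) * (2 * k + 1)) * ((2 * k + 1) * k.centralBinom ^ 2) := by rw [h]; ring
      _ ≤ 4 * (4 * (k + 1) ^ 2) * 16 ^ k := by
          exact Nat.mul_le_mul (Nat.mul_le_mul_left 4 (by nlinarith)) ih
      _ = (k + 1) ^ 2 * 16 ^ (k + 1) := by ring

/-- The Erdős–Littlewood–Offord bound. -/
lemma coinE_indicator_Ioc_le {d : ℝ} (hd : 0 < d) {L : List ℝ} {K : ℕ} (hL : L.length = 2 * K)
    (hD : ∀ D ∈ L, d ≤ D) (b : ℝ) :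
    coinE L ((Set.Ioc b (b + 2 * d)).indicator 1) ≤ 1 / √(2 * K + 1) := by
  classical
  set D : ℕ → ℝ := fun i => if i < L.length then L.getD i 0 else d with hDdef
  have hLD : L = (List.range L.length).map D := by
    apply List.ext_getElem
    · simp
    · intro i h1 h2
      simp [hDdef, h1]
  have hDd : ∀ i, d ≤ D i := by
    intro i
    simp only [hDdef]
    split_ifs with h
    · rw [List.getD_eq_getElem _ _ h]
      exact hD _ (List.getElem_mem h)
    · exact le_rfl
  rw [hLD, coinE_map_range, hL]
  set F : Finset ℕ → ℝ := fun A => ∑ i ∈ Finset.range (2 * K), if i ∈ A then D i else -D i with hF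
  set 𝒜 : Finset (Finset (Fin (2 * K))) :=
    Finset.univ.filter fun A => F (A.map Fin.valEmbedding) ∈ Set.Ioc b (b + 2 * d) with h𝒜
  have hanti : IsAntichain (· ⊆ ·) (𝒜 : Set (Finset (Fin (2 * K)))) := by
    intro A hA B hB hAB hsub
    simp only [h𝒜, Finset.coe_filter, Finset.mem_univ, true_and, Set.mem_ofPred_eq,
      Set.mem_Ioc] at hA hB
    obtain ⟨j, hjB, hjA⟩ := Finset.exists_of_ssubset (hsub.ssubset_of_ne hAB)
    have : F (A.map Fin.valEmbedding) + 2 * D j ≤ F (B.map Fin.valEmbedding) := by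
      have hj : (j : ℕ) ∈ Finset.range (2 * K) := by simp
      simp only [hF]
      rw [← Finset.add_sum_erase _ _ hj, ← Finset.add_sum_erase _ _ hj]
      have h1 : (j : ℕ) ∉ A.map Fin.valEmbedding := fun h => hjA ((Finset.mem_map' Fin.valEmbedding).1 h)
      have h2 : (j : ℕ) ∈ B.map Fin.valEmbedding := (Finset.mem_map' Fin.valEmbedding).2 hjB
      rw [if_neg h1, if_pos h2]
      have : ∑ x ∈ (Finset.range (2 * K)).erase ↑j,
          (if x ∈ A.map Fin.valEmbedding then D x else -D x) ≤
          ∑ x ∈ (Finset.range (2 * K)).erase ↑j,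
          (if x ∈ B.map Fin.valEmbedding then D x else -D x) := by
        refine Finset.sum_le_sum fun i _ => ?_
        have hi := hDd i
        split_ifs with h3 h4 h4
        · exact le_rfl
        · exact absurd (Finset.map_subset_map.2 hsub h3) h4
        · linarith
        · exact le_rfl
      linarith
    linarith [hDd j]
  have hsum : ∑ A ∈ (Finset.range (2 * K)).powerset,
      (Set.Ioc b (b + 2 * d)).indicator 1 (F A) = (𝒜.card : ℝ) := by
    simp only [Set.indicator_apply, Pi.one_apply]
    rw [Finset.sum_boole]
    congr 1
    symm
    refine Finset.card_bij (fun A _ => A.map Fin.valEmbedding) ?_ ?_ ?_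
    · intro A hA
      simp only [h𝒜, Finset.mem_filter, Finset.mem_univ, true_and] at hA
      simp only [Finset.mem_filter, Finset.mem_powerset]
      refine ⟨?_, hA⟩
      intro i hi
      simp only [Finset.mem_map] at hi
      obtain ⟨a, _, rfl⟩ := hi
      simp
    · intro A _ B _ h
      exact Finset.map_injective _ h
    · intro A hA
      simp only [Finset.mem_filter, Finset.mem_powerset] at hA
      have hA' : (A.attachFin fun i hi => Finset.mem_range.1 (hA.1 hi)).map Fin.valEmbedding = A := by
        ext i; simp
      refine ⟨A.attachFin fun i hi => Finset.mem_range.1 (hA.1 hi), ?_, hA'⟩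
      simp only [h𝒜, Finset.mem_filter, Finset.mem_univ, true_and]
      rw [hA']
      exact hA.2
  rw [hsum]
  have hsp : 𝒜.card ≤ K.centralBinom := by
    have := hanti.sperner
    rwa [Fintype.card_fin, Nat.mul_div_cancel_left _ two_pos] at this
  have hcb : √(2 * K + 1) * (K.centralBinom : ℝ) ≤ 2 ^ (2 * K) := by
    have h : ((2 * K + 1) * K.centralBinom ^ 2 : ℝ) ≤ 16 ^ K := by
      exact_mod_cast centralBinom_sq_le K
    refine abs_le_of_sq_le_sq' ?_ (by positivity) |>.2
    rw [mul_pow, Real.sq_sqrt (by positivity)]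
    calc _ ≤ _ := h
      _ = _ := by rw [← pow_mul, mul_comm (2 * K), ← mul_assoc, pow_mul]; norm_num
  rw [div_le_div_iff₀ (by positivity) (by positivity), one_mul]
  calc (𝒜.card : ℝ) * √(2 * K + 1) ≤ K.centralBinom * √(2 * K + 1) := by gcongr
    _ ≤ _ := by rw [mul_comm]; exact hcb

lemma coinE_indicator_Ioc_le_mul {d : ℝ} (hd : 0 < d) {L : List ℝ} {K : ℕ}
    (hL : L.length = 2 * K) (hD : ∀ D ∈ L, d ≤ D) (b : ℝ) {q : ℝ} (hq : 0 ≤ q) :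
    coinE L ((Set.Ioc b (b + q)).indicator 1) ≤ (q / d + 1) / √(2 * K + 1) := by
  have hp : ∀ p : ℕ, coinE L ((Set.Ioc b (b + 2 * d * p)).indicator 1) ≤ p / √(2 * K + 1) := by
    intro p
    induction p with
    | zero => simp [coinE_const]
    | succ p ih =>
      have h1 : ∀ s, (Set.Ioc b (b + 2 * d * (p + 1 : ℕ))).indicator (1 : ℝ → ℝ) s ≤
          (Set.Ioc b (b + 2 * d * p)).indicator 1 s +
          (Set.Ioc (b + 2 * d * p) (b + 2 * d * p + 2 * d)).indicator 1 s := by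
        intro s
        simp only [Set.indicator_apply, Pi.one_apply, Set.mem_Ioc]
        push_cast
        split_ifs with h2 h3 h4 h4 <;> try norm_num
        by_cases h5 : s ≤ b + 2 * d * p
        · exact h3 ⟨h2.1, h5⟩
        · exact h4 ⟨by linarith, by linarith [h2.2]⟩
      refine (coinE_mono L h1).trans ?_
      rw [coinE_add]
      have := coinE_indicator_Ioc_le hd hL hD (b + 2 * d * p)
      push_cast
      rw [add_div]
      linarith
  refine le_trans (coinE_mono L (g := (Set.Ioc b (b + 2 * d * ⌈q / (2 * d)⌉₊)).indicator 1)
    fun s => ?_) ((hp _).trans ?_)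
  · refine Set.indicator_le_indicator_of_subset (Set.Ioc_subset_Ioc_right ?_) (by simp) s
    have := Nat.le_ceil (q / (2 * d))
    rw [div_le_iff₀ (by positivity)] at this
    linarith
  · gcongr
    have h1 := Nat.ceil_lt_add_one (a := q / (2 * d)) (by positivity)
    have h2 : q / (2 * d) ≤ q / d := by gcongr; linarith
    linarith

/-- The Cauchy-type profile of width `σ`. -/
noncomputable def bump (σ z : ℝ) : ℝ := (1 + z ^ 2 / σ ^ 2)⁻¹

lemma bump_pos (σ z : ℝ) : 0 < bump σ z := by unfold bump; positivity

lemma bump_le_one (σ z : ℝ) : bump σ z ≤ 1 :=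
  inv_le_one_of_one_le₀ (by have : 0 ≤ z ^ 2 / σ ^ 2 := by positivity
                            linarith)

lemma bump_le_add (σ a b : ℝ) : bump σ a ≤ 2 * bump σ (a + b) * (1 + b ^ 2 / σ ^ 2) := by
  have h : 1 + (a + b) ^ 2 / σ ^ 2 ≤ 2 * (1 + a ^ 2 / σ ^ 2) * (1 + b ^ 2 / σ ^ 2) := by
    have h1 : (a + b) ^ 2 / σ ^ 2 ≤ (2 * a ^ 2 + 2 * b ^ 2) / σ ^ 2 := by
      gcongr; nlinarith [sq_nonneg (a - b)]
    have h2 : 0 ≤ a ^ 2 / σ ^ 2 * (b ^ 2 / σ ^ 2) := by positivity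
    rw [add_div, mul_div_assoc, mul_div_assoc] at h1
    nlinarith
  have h' : 1 + (a + b) ^ 2 / σ ^ 2 ≤ 2 * (1 + b ^ 2 / σ ^ 2) * (1 + a ^ 2 / σ ^ 2) := by linarith
  have h3 : 1 + a ^ 2 / σ ^ 2 ≤ 2 * (1 + b ^ 2 / σ ^ 2) * (1 + (a + b) ^ 2 / σ ^ 2) := by
    have h1 : a ^ 2 / σ ^ 2 ≤ (2 * (a + b) ^ 2 + 2 * b ^ 2) / σ ^ 2 := by
      gcongr; nlinarith [sq_nonneg (a + 2 * b)]
    have h2 : 0 ≤ (a + b) ^ 2 / σ ^ 2 * (b ^ 2 / σ ^ 2) := by positivity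
    rw [add_div, mul_div_assoc, mul_div_assoc] at h1
    nlinarith
  unfold bump
  rw [mul_right_comm, ← div_eq_mul_inv, inv_eq_one_div, div_le_div_iff₀ (by positivity)
    (by positivity)]
  linarith

lemma bump_le_coinE {σ : ℝ} (hσ : 0 < σ) {L : List ℝ} (hL : (L.map (· ^ 2)).sum ≤ σ ^ 2) (x : ℝ) :
    bump σ x ≤ 2 * coinE L (fun s => bump σ (x + s)) := by
  set v : ℝ := 2 * (1 + x ^ 2 / σ ^ 2) with hv
  have hv0 : 0 < v := by positivity
  have h1 : ∀ s, (2 / v - (1 / v ^ 2)) + (-(1 / (v ^ 2 * σ ^ 2))) * (x + s) ^ 2 ≤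
      bump σ (x + s) := by
    intro s
    set u : ℝ := 1 + (x + s) ^ 2 / σ ^ 2 with hu
    have hu0 : 0 < u := by positivity
    have : bump σ (x + s) = 1 / u := by rw [bump, one_div]
    rw [this]
    have h2 : (2 / v - (1 / v ^ 2)) + (-(1 / (v ^ 2 * σ ^ 2))) * (x + s) ^ 2 = 2 / v - u / v ^ 2 := by
      rw [hu]; field_simp; ring
    rw [h2]
    have : 1 / u - (2 / v - u / v ^ 2) = (u - v) ^ 2 / (u * v ^ 2) := by field_simp; ring
    have h3 : 0 ≤ (u - v) ^ 2 / (u * v ^ 2) := by positivity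
    linarith
  have h2 := coinE_mono L h1
  rw [coinE_add, coinE_const, coinE_const_mul, coinE_add_sq] at h2
  have h3 : (1 / (v ^ 2 * σ ^ 2)) * (L.map (· ^ 2)).sum ≤ 1 / v ^ 2 := by
    calc _ ≤ (1 / (v ^ 2 * σ ^ 2)) * σ ^ 2 := by gcongr
      _ = _ := by field_simp
  have h4 : bump σ x = 2 / v := by rw [bump, hv]; field_simp
  have h5 : 2 / v - 1 / v ^ 2 - 1 / (v ^ 2 * σ ^ 2) * x ^ 2 - 1 / v ^ 2 ≥ 1 / v := by
    have : 2 / v - 1 / v ^ 2 - 1 / (v ^ 2 * σ ^ 2) * x ^ 2 - 1 / v ^ 2 =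
        1 / v + (v - 2 - x ^ 2 / σ ^ 2) / v ^ 2 := by field_simp; ring
    rw [this]
    have : 0 ≤ (v - 2 - x ^ 2 / σ ^ 2) / v ^ 2 := by
      apply div_nonneg _ (by positivity)
      have : 0 ≤ x ^ 2 / σ ^ 2 := by positivity
      rw [hv]; linarith
    linarith
  rw [h4]
  have h6 : 2 / v = 2 * (1 / v) := by ring
  rw [h6]
  linarith

/-- A uniform bound for two independent coin sums improves to a decaying one for their sum. -/
lemma coinE_append_le_bump {σ : ℝ} (hσ : 0 < σ) {L₁ L₂ : List ℝ}
    (hL₁ : (L₁.map (· ^ 2)).sum ≤ σ ^ 2) (hL₂ : (L₂.map (· ^ 2)).sum ≤ σ ^ 2)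
    {f : ℝ → ℝ} (hf : ∀ z, 0 ≤ f z) {B : ℝ} (hB : ∀ z, f z ≠ 0 → |z| ≤ B * σ) {p : ℝ}
    (h₁ : ∀ z, coinE L₁ (fun s => f (z + s)) ≤ p) (h₂ : ∀ z, coinE L₂ (fun s => f (z + s)) ≤ p)
    (x : ℝ) :
    coinE (L₁ ++ L₂) (fun s => f (x + s)) ≤ (7 + 3 * B ^ 2) * p * bump σ x := by
  have hp : 0 ≤ p := (coinE_nonneg L₁ fun s => hf _).trans (h₁ 0)
  have hpt : ∀ s t, (1 + x ^ 2 / σ ^ 2) * f (x + (s + t)) ≤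
      (1 + 3 * B ^ 2) * f (x + (s + t)) + ((3 / σ ^ 2) * (s ^ 2 * f (x + (s + t))) +
        (3 / σ ^ 2) * (t ^ 2 * f (x + (s + t)))) := by
    intro s t
    by_cases h0 : f (x + (s + t)) = 0
    · simp [h0]
    have h1 := sq_le_sq' (by linarith [neg_abs_le (x + (s + t)), hB _ h0])
      ((le_abs_self _).trans (hB _ h0))
    have h2 : x ^ 2 ≤ 3 * ((B * σ) ^ 2 + s ^ 2 + t ^ 2) := by
      nlinarith [sq_nonneg (x + s + t + s), sq_nonneg (x + s + t + t), sq_nonneg (s - t)]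
    have h3 : x ^ 2 / σ ^ 2 ≤ 3 * B ^ 2 + 3 / σ ^ 2 * s ^ 2 + 3 / σ ^ 2 * t ^ 2 := by
      rw [div_le_iff₀ (by positivity)]
      field_simp
      linarith
    have := mul_le_mul_of_nonneg_right h3 (hf (x + (s + t)))
    linarith
  have hA : coinE L₁ (fun s => coinE L₂ fun t => f (x + (s + t))) ≤ p := by
    have h : ∀ s, coinE L₂ (fun t => f (x + (s + t))) ≤ p := fun s => by
      simpa only [add_assoc] using h₂ (x + s)
    simpa [coinE_const] using coinE_mono L₁ h
  have hB' : coinE L₁ (fun s => coinE L₂ fun t => s ^ 2 * f (x + (s + t))) ≤ p * σ ^ 2 := by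
    have h : ∀ s, coinE L₂ (fun t => s ^ 2 * f (x + (s + t))) ≤ p * s ^ 2 := fun s => by
      rw [coinE_const_mul, mul_comm p]
      gcongr
      simpa only [add_assoc] using h₂ (x + s)
    refine (coinE_mono L₁ h).trans ?_
    rw [coinE_const_mul, coinE_sq]
    gcongr
  have hC : coinE L₁ (fun s => coinE L₂ fun t => t ^ 2 * f (x + (s + t))) ≤ p * σ ^ 2 := by
    rw [coinE_comm]
    have h : ∀ t, coinE L₁ (fun s => t ^ 2 * f (x + (s + t))) ≤ p * t ^ 2 := fun t => by
      rw [coinE_const_mul, mul_comm p]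
      gcongr
      simpa only [add_assoc, add_comm t] using h₁ (x + t)
    refine (coinE_mono L₂ h).trans ?_
    rw [coinE_const_mul, coinE_sq]
    gcongr
  have hmain := coinE_mono L₁ fun s => coinE_mono L₂ (hpt s)
  simp only [coinE_const_mul, coinE_add] at hmain
  simp only [coinE_const_mul] at hB' hC
  rw [coinE_append, bump, ← div_eq_mul_inv, le_div_iff₀ (by positivity)]
  have e1 : 3 / σ ^ 2 * (p * σ ^ 2) = 3 * p := by field_simp
  have h3 : 0 ≤ 3 / σ ^ 2 := by positivity
  nlinarith [mul_le_mul_of_nonneg_left hB' h3, mul_le_mul_of_nonneg_left hC h3,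
    mul_le_mul_of_nonneg_left hA (by positivity : 0 ≤ 1 + 3 * B ^ 2)]

lemma coinE_nonneg_of_odd_monotone (L : List ℝ) {φ : ℝ → ℝ} (hodd : ∀ z, φ (-z) = -φ z)
    (hmono : Monotone φ) {t : ℝ} (ht : 0 ≤ t) : 0 ≤ coinE L (fun s => φ (t + 2 * s)) := by
  have h1 : coinE L (fun s => φ (t + 2 * s)) = coinE L (fun s => φ (t - 2 * s)) := by
    rw [← coinE_neg]; simp [sub_eq_add_neg]
  have h2 : 0 ≤ coinE L (fun s => φ (t + 2 * s) + φ (t - 2 * s)) := by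
    refine coinE_nonneg L fun s => ?_
    have := hmono (show -(t - 2 * s) ≤ t + 2 * s by linarith)
    rw [hodd] at this
    linarith
  rw [coinE_add, ← h1] at h2
  linarith

/-- Reflection coupling: two copies of the coin walk with initial gap `s` move in opposite
directions until the gap drops to at most `0`, and in parallel from then on. The function `φ`,
odd about the largest overshoot `c`, dominates the contribution of walks that never meet. -/
lemma abs_coinE_sub_le_of_reflection {c : ℝ} (hc : 0 ≤ c) {G e φ : ℝ → ℝ}
    (he : ∀ z, 0 ≤ e z)
    (hGe : ∀ z u, -c ≤ u → u ≤ 0 → |G z - G (z + u)| ≤ e z) (hodd : ∀ z, φ (-z) = -φ z)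
    (hmono : Monotone φ) (y : ℝ) (hφ : ∀ s, 0 < s → |G (y - s / 2) - G (y + s / 2)| ≤ φ (s + c))
    (L : List ℝ) (hL : ∀ D ∈ L, 0 ≤ D ∧ 2 * D ≤ c) (s : ℝ) (hs : -c ≤ s) :
    |coinE L (fun t => G (y - s / 2 + t)) - coinE L (fun t => G (y + s / 2 + t))| ≤
      coinE L (fun t => e (y - s / 2 + t)) + coinE L (fun t => φ (s + c + 2 * t)) := by
  have hneg : ∀ (L : List ℝ) (s : ℝ), -c ≤ s → s ≤ 0 →
      |coinE L (fun t => G (y - s / 2 + t)) - coinE L (fun t => G (y + s / 2 + t))| ≤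
      coinE L (fun t => e (y - s / 2 + t)) + coinE L (fun t => φ (s + c + 2 * t)) := by
    intro L s hs hs0
    have h1 := coinE_nonneg_of_odd_monotone L hodd hmono (show 0 ≤ s + c by linarith)
    rw [← coinE_sub]
    have h2 := abs_coinE_le L (f := fun t => G (y - s / 2 + t) - G (y + s / 2 + t))
      (g := fun t => e (y - s / 2 + t)) fun t => by
        have := hGe (y - s / 2 + t) s hs hs0
        rwa [show y - s / 2 + t + s = y + s / 2 + t by ring] at this
    linarith
  induction L generalizing s with
  | nil =>
    rcases le_or_gt s 0 with h | h
    · exact hneg _ s hs h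
    · simp only [coinE, add_zero, mul_zero]
      linarith [hφ s h, he (y - s / 2)]
  | cons D L ih =>
    rcases le_or_gt s 0 with h | h
    · exact hneg _ s hs h
    · have hD := hL D (by simp)
      have hL' : ∀ D ∈ L, 0 ≤ D ∧ 2 * D ≤ c := fun D hD => hL D (by simp [hD])
      have i1 := ih hL' (s + 2 * D) (by linarith)
      have i2 := ih hL' (s - 2 * D) (by linarith)
      have r1 : ∀ F : ℝ → ℝ, (fun t => F (y - s / 2 + (t - D))) =
          fun t => F (y - (s + 2 * D) / 2 + t) := fun F => by funext t; congr 1; ring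
      have r2 : ∀ F : ℝ → ℝ, (fun t => F (y - s / 2 + (t + D))) =
          fun t => F (y - (s - 2 * D) / 2 + t) := fun F => by funext t; congr 1; ring
      have r3 : ∀ F : ℝ → ℝ, (fun t => F (y + s / 2 + (t - D))) =
          fun t => F (y + (s - 2 * D) / 2 + t) := fun F => by funext t; congr 1; ring
      have r4 : ∀ F : ℝ → ℝ, (fun t => F (y + s / 2 + (t + D))) =
          fun t => F (y + (s + 2 * D) / 2 + t) := fun F => by funext t; congr 1; ring
      have r5 : (fun t => φ (s + c + 2 * (t - D))) =
          fun t => φ (s - 2 * D + c + 2 * t) := by funext t; congr 1; ring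
      have r6 : (fun t => φ (s + c + 2 * (t + D))) =
          fun t => φ (s + 2 * D + c + 2 * t) := by funext t; congr 1; ring
      simp only [coinE]
      rw [r1 G, r2 G, r3 G, r4 G, r1 e, r2 e, r5, r6]
      rw [abs_le] at i1 i2 ⊢
      constructor <;> linarith [i1.1, i1.2, i2.1, i2.2]

/-- The odd extension of the weight `1 + z ^ 2 / σ ^ 2`. -/
noncomputable def oddWeight (σ z : ℝ) : ℝ :=
  if 0 < z then 1 + z ^ 2 / σ ^ 2 else if z < 0 then -(1 + z ^ 2 / σ ^ 2) else 0

lemma oddWeight_of_pos (σ : ℝ) {z : ℝ} (hz : 0 < z) : oddWeight σ z = 1 + z ^ 2 / σ ^ 2 :=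
  if_pos hz

lemma oddWeight_neg (σ z : ℝ) : oddWeight σ (-z) = -oddWeight σ z := by
  unfold oddWeight
  rcases lt_trichotomy z 0 with h | rfl | h
  · simp [h, h.not_gt]
  · simp
  · simp [h, h.not_gt]

lemma oddWeight_monotone (σ : ℝ) : Monotone (oddWeight σ) := by
  have h0 : ∀ z, 0 ≤ z → 0 ≤ oddWeight σ z := by
    intro z hz
    unfold oddWeight
    rw [if_neg (show ¬ z < 0 by linarith)]
    split_ifs <;> positivity
  have h1 : ∀ a b, 0 ≤ a → a ≤ b → oddWeight σ a ≤ oddWeight σ b := by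
    intro a b ha hab
    rcases ha.eq_or_lt with rfl | ha
    · have : oddWeight σ 0 = 0 := by simp [oddWeight]
      rw [this]; exact h0 b hab
    · rw [oddWeight_of_pos σ ha, oddWeight_of_pos σ (ha.trans_le hab)]
      gcongr
  intro a b hab
  rcases le_total 0 a with ha | ha
  · exact h1 a b ha hab
  rcases le_total 0 b with hb | hb
  · have := h0 (-a) (by linarith)
    rw [oddWeight_neg] at this
    linarith [h0 b hb]
  · have := h1 (-b) (-a) (by linarith) (by linarith)
    rw [oddWeight_neg, oddWeight_neg] at this
    linarith

lemma coinE_oddWeight_le {σ d : ℝ} (hσ : 0 < σ) (hd : 0 < d) {L : List ℝ} {K : ℕ}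
    (hlen : L.length = 2 * K) (hD : ∀ D ∈ L, d ≤ D) (hL : (L.map (· ^ 2)).sum ≤ σ ^ 2)
    {t : ℝ} (ht : 0 < t) (htσ : t ≤ 2 * σ) :
    coinE L (fun s => oddWeight σ (t + 2 * s)) ≤
      17 * ((t / d + 2) / √(2 * K + 1)) + 4 * (t / σ) := by
  have hsym : coinE L (fun s => oddWeight σ (t + 2 * s)) =
      coinE L (fun s => oddWeight σ (t - 2 * s)) := by
    rw [← coinE_neg]; simp [sub_eq_add_neg]
  have hind := coinE_indicator_Ioc_le_mul hd hlen hD (-(t / 2) - d) (q := t + d) (by positivity)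
  have hpt : ∀ s, oddWeight σ (t + 2 * s) + oddWeight σ (t - 2 * s) ≤
      34 * (Set.Ioc (-(t / 2) - d) (-(t / 2) - d + (t + d))).indicator 1 s +
        (4 * t / σ ^ 3 * s ^ 2 + 4 * t / σ) := by
    intro s
    have hrest : 8 * t * |s| / σ ^ 2 ≤ 4 * t / σ ^ 3 * s ^ 2 + 4 * t / σ := by
      have : 4 * t / σ ^ 3 * s ^ 2 + 4 * t / σ - 8 * t * |s| / σ ^ 2 =
          4 * t / σ ^ 3 * (|s| - σ) ^ 2 := by
        field_simp; rw [← sq_abs s]; ring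
      have h2 : 0 ≤ 4 * t / σ ^ 3 * (|s| - σ) ^ 2 := by positivity
      linarith
    by_cases hs : |2 * s| ≤ t
    · have hs' := abs_le.1 hs
      have hmem : s ∈ Set.Ioc (-(t / 2) - d) (-(t / 2) - d + (t + d)) :=
        ⟨by linarith [hs'.1], by linarith [hs'.2]⟩
      rw [Set.indicator_of_mem hmem, Pi.one_apply]
      have hb : ∀ z, z ≤ 2 * t → oddWeight σ z ≤ 17 := by
        intro z hz
        refine (oddWeight_monotone σ hz).trans ?_
        rw [oddWeight_of_pos σ (by linarith)]
        have : (2 * t) ^ 2 / σ ^ 2 ≤ 16 := by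
          rw [div_le_iff₀ (by positivity)]; nlinarith
        linarith
      have : 0 ≤ 4 * t / σ ^ 3 * s ^ 2 + 4 * t / σ := by positivity
      linarith [hb (t + 2 * s) (by linarith), hb (t - 2 * s) (by linarith)]
    · have hi : 0 ≤ (Set.Ioc (-(t / 2) - d) (-(t / 2) - d + (t + d))).indicator (1 : ℝ → ℝ) s :=
        Set.indicator_nonneg (by simp) s
      have hcase : ∀ v, t < v → oddWeight σ (t + v) + oddWeight σ (t - v) = 4 * t * v / σ ^ 2 := by
        intro v hv
        rw [show t - v = -(v - t) by ring, oddWeight_neg, oddWeight_of_pos σ (by linarith),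
          oddWeight_of_pos σ (by linarith)]
        field_simp; ring
      have : oddWeight σ (t + 2 * s) + oddWeight σ (t - 2 * s) = 8 * t * |s| / σ ^ 2 := by
        rcases lt_abs.1 (not_le.1 hs) with h | h
        · rw [hcase _ h, abs_of_pos (by linarith)]; ring
        · have := hcase _ h
          rw [← sub_eq_add_neg, sub_neg_eq_add] at this
          rw [add_comm, this, abs_of_neg (by linarith)]; ring
      linarith
  have h := coinE_mono L hpt
  rw [coinE_add, ← hsym, coinE_add, coinE_const_mul, coinE_add, coinE_const_mul, coinE_sq,
    coinE_const] at h
  have h3 : 4 * t / σ ^ 3 * (L.map (· ^ 2)).sum ≤ 4 * t / σ := by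
    calc _ ≤ 4 * t / σ ^ 3 * σ ^ 2 := by gcongr
      _ = _ := by field_simp
  have h4 : (t + d) / d + 1 = t / d + 2 := by field_simp; ring
  rw [h4] at hind
  have h5 : 4 * (t / σ) = 4 * t / σ := by ring
  rw [h5]
  linarith

lemma coinE_bump_le {σ : ℝ} (hσ : 0 < σ) {L : List ℝ} (hL : (L.map (· ^ 2)).sum ≤ σ ^ 2) (x : ℝ) :
    coinE L (fun s => bump σ (x + s)) ≤ 4 * bump σ x := by
  have h : ∀ s, bump σ (x + s) ≤ 2 * bump σ x * (1 + 1 / σ ^ 2 * s ^ 2) := by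
    intro s
    have := bump_le_add σ (x + s) (-s)
    rw [add_neg_cancel_right, neg_sq] at this
    rwa [one_div_mul_eq_div]
  refine (coinE_mono L h).trans ?_
  rw [coinE_const_mul, coinE_add, coinE_const, coinE_const_mul, coinE_sq]
  have : 1 / σ ^ 2 * (L.map (· ^ 2)).sum ≤ 1 := by
    calc _ ≤ 1 / σ ^ 2 * σ ^ 2 := by gcongr
      _ = 1 := by field_simp
  nlinarith [bump_pos σ x]

lemma sum_sq_le {d : ℝ} {L : List ℝ} (hD : ∀ D ∈ L, 0 ≤ D ∧ D ≤ d) :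
    (L.map (· ^ 2)).sum ≤ L.length * d ^ 2 := by
  induction L with
  | nil => simp
  | cons D L ih =>
    have h1 := ih fun D hD' => hD D (by simp [hD'])
    have h2 := hD D (by simp)
    have h3 : D ^ 2 ≤ d ^ 2 := pow_le_pow_left₀ h2.1 h2.2 2
    simp only [List.map_cons, List.sum_cons, List.length_cons]
    push_cast
    linarith

/-- The local smoothness of coin sums: shifting an interval changes its probability little. -/
lemma abs_coinE_indicator_sub_le {d σ ℓ s : ℝ} {K : ℕ} (hK : 1 ≤ K) (hd : 0 < d)
    (hσ : 288 * K * d ^ 2 ≤ σ ^ 2) (hσ0 : 0 < σ) (hdℓ : d ≤ ℓ) (hℓs : ℓ ≤ s) (hsσ : s ≤ σ)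
    (hdσ : 24 * d ≤ σ) {L : List ℝ} (hlen : L.length = 6 * K) (hL : ∀ D ∈ L, d ≤ D ∧ D ≤ 12 * d)
    (x : ℝ) :
    |coinE L (fun t => (Set.Ioc 0 ℓ).indicator (1 : ℝ → ℝ) (x + t)) -
      coinE L (fun t => (Set.Ioc 0 ℓ).indicator (1 : ℝ → ℝ) (x + s + t))| ≤
      (10 ^ 5 / √(2 * K + 1) + 10 ^ 5 * (ℓ * s) / (d ^ 2 * (2 * K + 1))) * bump σ x := by
  obtain ⟨L₁, L₂, L₃, rfl, hl₁, hl₂, hl₃⟩ : ∃ L₁ L₂ L₃ : List ℝ, L = L₁ ++ (L₂ ++ L₃) ∧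
      L₁.length = 2 * K ∧ L₂.length = 2 * K ∧ L₃.length = 2 * K :=
    ⟨L.take (2 * K), (L.drop (2 * K)).take (2 * K), (L.drop (2 * K)).drop (2 * K), by simp,
      by simp; omega, by simp; omega, by simp; omega⟩
  have hs0 : 0 < s := by linarith
  have hL₁ : ∀ D ∈ L₁, d ≤ D ∧ D ≤ 12 * d := fun D hD => hL D (by simp [hD])
  have hL₂ : ∀ D ∈ L₂, d ≤ D ∧ D ≤ 12 * d := fun D hD => hL D (by simp [hD])
  have hL₃ : ∀ D ∈ L₃, d ≤ D ∧ D ≤ 12 * d := fun D hD => hL D (by simp [hD])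
  have hsq : ∀ L' : List ℝ, L'.length = 2 * K → (∀ D ∈ L', d ≤ D ∧ D ≤ 12 * d) →
      (L'.map (· ^ 2)).sum ≤ σ ^ 2 := by
    intro L' h1 h2
    refine (sum_sq_le (d := 12 * d) fun D hD => ⟨hd.le.trans (h2 D hD).1, (h2 D hD).2⟩).trans ?_
    rw [h1]; push_cast
    linarith
  set W := √(2 * K + 1) with hW
  have hW0 : 0 < W := by positivity
  have hWsq : W ^ 2 = 2 * K + 1 := Real.sq_sqrt (by positivity)
  have hdW : d * W ≤ σ := by
    have hK' : (1 : ℝ) ≤ K := by exact_mod_cast hK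
    refine abs_le_of_sq_le_sq' ?_ hσ0.le |>.2
    rw [mul_pow, hWsq]
    nlinarith [sq_nonneg d]
  set g : ℝ → ℝ := (Set.Ioc 0 ℓ).indicator 1 with hg
  set e : ℝ → ℝ := fun z => (Set.Ioc 0 (0 + 24 * d)).indicator 1 z +
    (Set.Ioc ℓ (ℓ + 24 * d)).indicator 1 z with he
  have hg0 : ∀ z, 0 ≤ g z := Set.indicator_nonneg (by simp)
  have he0 : ∀ z, 0 ≤ e z := fun z =>
    add_nonneg (Set.indicator_nonneg (by simp) z) (Set.indicator_nonneg (by simp) z)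
  have hLO : ∀ L' : List ℝ, L'.length = 2 * K → (∀ D ∈ L', d ≤ D ∧ D ≤ 12 * d) →
      ∀ b q : ℝ, 0 ≤ q → ∀ z, coinE L' (fun t => (Set.Ioc b (b + q)).indicator (1 : ℝ → ℝ) (z + t)) ≤
        (q / d + 1) / W := by
    intro L' h1 h2 b q hq z
    have h := coinE_indicator_Ioc_le_mul hd h1 (fun D hD => (h2 D hD).1) (b - z) hq
    convert h using 3 with t
    simp only [Set.indicator_apply, Set.mem_Ioc]
    congr 1
    apply propext
    constructor <;> rintro ⟨h1, h2⟩ <;> constructor <;> linarith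
  set p : ℝ := 20 * (ℓ / (d * W)) with hp
  have hp0 : 0 ≤ p := by have : 0 < ℓ := by linarith
                         positivity
  have hG : ∀ z, coinE (L₂ ++ L₃) (fun t => g (z + t)) ≤ p * bump σ z := by
    intro z
    have hB : ∀ z, g z ≠ 0 → |z| ≤ 1 * σ := by
      intro z hz
      have := Set.mem_of_indicator_ne_zero hz
      rw [abs_of_pos this.1]; linarith [this.2]
    have h0 : ∀ z, (Set.Ioc 0 (0 + ℓ)).indicator (1 : ℝ → ℝ) z = g z := by simp [hg]
    have := coinE_append_le_bump hσ0 (hsq _ hl₂ hL₂) (hsq _ hl₃ hL₃) hg0 hB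
      (p := (ℓ / d + 1) / W)
      (fun z => by simpa only [h0] using hLO L₂ hl₂ hL₂ 0 ℓ (by linarith) z)
      (fun z => by simpa only [h0] using hLO L₃ hl₃ hL₃ 0 ℓ (by linarith) z) z
    refine this.trans ?_
    have hb := bump_pos σ z
    gcongr
    rw [hp, ← div_div]
    have : 1 ≤ ℓ / d := by rwa [one_le_div hd]
    rw [mul_div_assoc', mul_div_assoc']
    exact div_le_div_of_nonneg_right (by linarith) hW0.le
  have hE : ∀ z, coinE (L₂ ++ L₃) (fun t => e (z + t)) ≤ (950 / W) * bump σ z := by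
    intro z
    have hB : ∀ z, e z ≠ 0 → |z| ≤ 2 * σ := by
      intro z hz
      have : z ∈ Set.Ioc 0 (0 + 24 * d) ∨ z ∈ Set.Ioc ℓ (ℓ + 24 * d) := by
        by_contra! hcon
        refine hz ?_
        simp only [he]
        rw [Set.indicator_of_notMem hcon.1, Set.indicator_of_notMem hcon.2, add_zero]
      rcases this with h | h
      · rw [abs_of_pos h.1]; linarith [h.2]
      · rw [abs_of_pos (by linarith [h.1])]; linarith [h.2]
    have hu : ∀ L' : List ℝ, L'.length = 2 * K → (∀ D ∈ L', d ≤ D ∧ D ≤ 12 * d) →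
        ∀ z, coinE L' (fun t => e (z + t)) ≤ 50 / W := by
      intro L' h1 h2 z
      simp only [he]
      rw [coinE_add]
      have i1 := hLO L' h1 h2 0 (24 * d) (by positivity) z
      have i2 := hLO L' h1 h2 ℓ (24 * d) (by positivity) z
      have i3 : (24 * d / d + 1) / W = 25 / W := by field_simp; norm_num
      rw [i3] at i1 i2
      have i4 : 50 / W = 25 / W + 25 / W := by ring
      linarith
    refine (coinE_append_le_bump hσ0 (hsq _ hl₂ hL₂) (hsq _ hl₃ hL₃) he0 hB
      (hu L₂ hl₂ hL₂) (hu L₃ hl₃ hL₃) z).trans (le_of_eq ?_)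
    ring
  have hge : ∀ z u, -(24 * d) ≤ u → u ≤ 0 → |g z - g (z + u)| ≤ e z := by
    intro z u hu hu0
    simp only [hg, he, Set.indicator_apply, Set.mem_Ioc, Pi.one_apply]
    split_ifs <;> norm_num <;> exfalso <;> grind
  have hmain := abs_coinE_sub_le_of_reflection (c := 24 * d) (by positivity)
    (G := fun z => coinE (L₂ ++ L₃) (fun t => g (z + t)))
    (e := fun z => coinE (L₂ ++ L₃) (fun t => e (z + t)))
    (φ := fun z => 2 * p * bump σ (x + s / 2) * oddWeight σ z)
    (fun z => coinE_nonneg _ fun t => he0 _)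
    (fun z u h1 h2 => by
      rw [← coinE_sub]
      refine abs_coinE_le _ fun t => ?_
      have := hge (z + t) u h1 h2
      rwa [show z + t + u = z + u + t by ring] at this)
    (fun z => by simp only [oddWeight_neg]; ring)
    (fun a b hab => mul_le_mul_of_nonneg_left (oddWeight_monotone σ hab)
      (mul_nonneg (by positivity) (bump_pos _ _).le))
    (x + s / 2)
    (fun u hu => by
      have hb : ∀ v, |v| = u / 2 → bump σ (x + s / 2 + v) ≤
          2 * bump σ (x + s / 2) * oddWeight σ (u + 24 * d) := by
        intro v hv
        have h1 := bump_le_add σ (x + s / 2 + v) (-v)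
        rw [add_neg_cancel_right, neg_sq, ← sq_abs, hv] at h1
        refine h1.trans ?_
        rw [oddWeight_of_pos σ (by positivity)]
        have := bump_pos σ (x + s / 2)
        gcongr
        linarith
      have h1 := hb (-(u / 2)) (by rw [abs_neg, abs_of_pos (by positivity)])
      have h2 := hb (u / 2) (by rw [abs_of_pos (by positivity)])
      have h3 := hG (x + s / 2 - u / 2)
      have h4 := hG (x + s / 2 + u / 2)
      rw [← sub_eq_add_neg] at h1
      have h5 := coinE_nonneg (L₂ ++ L₃) fun t => hg0 (x + s / 2 - u / 2 + t)
      have h6 := coinE_nonneg (L₂ ++ L₃) fun t => hg0 (x + s / 2 + u / 2 + t)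
      have h7 := mul_le_mul_of_nonneg_left h1 hp0
      have h8 := mul_le_mul_of_nonneg_left h2 hp0
      rw [abs_le]
      constructor <;> linarith)
    L₁ (fun D hD => ⟨by linarith [(hL₁ D hD).1], by linarith [(hL₁ D hD).2]⟩) s (by linarith)
  rw [coinE_append, coinE_append]
  have hr1 : x + s / 2 - s / 2 = x := by ring
  have hr2 : x + s / 2 + s / 2 = x + s := by ring
  rw [hr1, hr2, coinE_const_mul] at hmain
  simp only [← add_assoc] at hmain ⊢
  refine hmain.trans ?_
  have hfirst : coinE L₁ (fun t => coinE (L₂ ++ L₃) (fun t' => e (x + t + t'))) ≤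
      3800 / W * bump σ x := by
    have h : ∀ t, coinE (L₂ ++ L₃) (fun t' => e (x + t + t')) ≤ 950 / W * bump σ (x + t) := by
      intro t
      exact hE (x + t)
    refine (coinE_mono _ h).trans ?_
    rw [coinE_const_mul]
    calc _ ≤ 950 / W * (4 * bump σ x) := by
          gcongr
          exact coinE_bump_le hσ0 (hsq _ hl₁ hL₁) x
      _ = _ := by ring
  have hsecond : coinE L₁ (fun t => oddWeight σ (s + 24 * d + 2 * t)) ≤ 600 * (s / (d * W)) := by
    refine (coinE_oddWeight_le hσ0 hd hl₁ (fun D hD => (hL₁ D hD).1) (hsq _ hl₁ hL₁)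
      (t := s + 24 * d) (by positivity) (by linarith)).trans ?_
    rw [← hW]
    have h1 : (s + 24 * d) / d + 2 ≤ 27 * (s / d) := by
      have : 1 ≤ s / d := by rw [one_le_div hd]; linarith
      rw [add_div, mul_div_assoc, div_self hd.ne']
      linarith
    have h2 : (s + 24 * d) / σ ≤ 25 * s / (d * W) := by
      gcongr
      linarith
    have h3 : ((s + 24 * d) / d + 2) / W ≤ 27 * (s / (d * W)) := by
      rw [← div_div, mul_div_assoc']
      gcongr
    have h4 : 25 * s / (d * W) = 25 * (s / (d * W)) := by ring
    have h5 : 0 ≤ s / (d * W) := by positivity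
    rw [h4] at h2
    linarith
  have hbump : bump σ (x + s / 2) ≤ 4 * bump σ x := by
    have h1 := bump_le_add σ (x + s / 2) (-(s / 2))
    rw [add_neg_cancel_right] at h1
    have h2 : (-(s / 2)) ^ 2 / σ ^ 2 ≤ 1 := by
      rw [div_le_one (by positivity)]; nlinarith
    nlinarith [bump_pos σ x]
  have hlast : 2 * p * bump σ (x + s / 2) * coinE L₁ (fun t => oddWeight σ (s + 24 * d + 2 * t)) ≤
      2 * p * (4 * bump σ x) * (600 * (s / (d * W))) := by
    have := bump_pos σ x
    have := coinE_nonneg_of_odd_monotone L₁ (oddWeight_neg σ) (oddWeight_monotone σ)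
      (show 0 ≤ s + 24 * d by positivity)
    gcongr
  have hb := bump_pos σ x
  have hfin : 2 * p * (4 * bump σ x) * (600 * (s / (d * W))) =
      96000 * (ℓ * s) / (d ^ 2 * (2 * K + 1)) * bump σ x := by
    rw [hp, ← hWsq]; field_simp; ring
  rw [hfin] at hlast
  have hℓ0 : 0 < ℓ := by linarith
  have h8 : 3800 / W * bump σ x ≤ 10 ^ 5 / W * bump σ x := by gcongr; norm_num
  have h9 : 96000 * (ℓ * s) / (d ^ 2 * (2 * K + 1)) * bump σ x ≤
      10 ^ 5 * (ℓ * s) / (d ^ 2 * (2 * K + 1)) * bump σ x := by gcongr; norm_num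
  rw [add_mul]
  linarith

/-- The expectation of `h (x + X)` for `X` of law `ν`. -/
noncomputable def lawAvg (ν : Measure ℤ) (h : ℝ → ℝ) (x : ℝ) : ℝ := ∫ k, h (x + k) ∂ν

/-- Averaging the bounded function `h` over `j` independent coins of size in `[d, 12 d]` gives
at least `-b / 2 ^ j`. -/
structure CoinBounded (d b : ℝ) (h : ℝ → ℝ) : Prop where
  nonneg : 0 ≤ b
  bounded : ∃ C, ∀ x, |h x| ≤ C
  le_coinE : ∀ L : List ℝ, (∀ D ∈ L, d ≤ D ∧ D ≤ 12 * d) → ∀ x,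
    -(b / 2 ^ L.length) ≤ coinE L (fun t => h (x + t))

lemma integrable_int_of_bounded (ν : Measure ℤ) [IsFiniteMeasure ν] {h : ℤ → ℝ} {C : ℝ}
    (hC : ∀ x, |h x| ≤ C) : Integrable h ν :=
  Integrable.of_bound (Measurable.of_discrete).aestronglyMeasurable C (ae_of_all _ hC)

lemma abs_lawAvg_le (ν : Measure ℤ) [IsProbabilityMeasure ν] {h : ℝ → ℝ} {C : ℝ}
    (hC : ∀ x, |h x| ≤ C) (x : ℝ) : |lawAvg ν h x| ≤ C := by
  simpa [lawAvg] using norm_integral_le_of_norm_le_const (μ := ν) (f := fun k : ℤ => h (x + k))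
    (ae_of_all _ fun k => by simpa using hC (x + k))

lemma coinE_integral (ν : Measure ℤ) (L : List ℝ) {F : ℝ → ℤ → ℝ} (hF : ∀ t, Integrable (F t) ν) :
    coinE L (fun t => ∫ k, F t k ∂ν) = ∫ k, coinE L (fun t => F t k) ∂ν ∧
      Integrable (fun k => coinE L (fun t => F t k)) ν := by
  induction L generalizing F with
  | nil => exact ⟨rfl, hF 0⟩
  | cons D L ih =>
    have h1 := ih fun t => hF (t - D)
    have h2 := ih fun t => hF (t + D)
    simp only [coinE]
    rw [h1.1, h2.1, integral_div, integral_add h1.2 h2.2]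
    exact ⟨rfl, (h1.2.add h2.2).div_const 2⟩

lemma coinE_lawAvg (ν : Measure ℤ) [IsProbabilityMeasure ν] (L : List ℝ) {h : ℝ → ℝ} {C : ℝ}
    (hC : ∀ x, |h x| ≤ C) (x : ℝ) :
    coinE L (fun t => lawAvg ν h (x + t)) = lawAvg ν (fun y => coinE L (fun t => h (y + t))) x := by
  simp only [lawAvg]
  rw [(coinE_integral ν L fun t => integrable_int_of_bounded ν fun k => hC (x + t + k)).1]
  simp only [add_right_comm]

lemma CoinBounded.coinE {d b : ℝ} {h : ℝ → ℝ} (hh : CoinBounded d b h) {L : List ℝ}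
    (hL : ∀ D ∈ L, d ≤ D ∧ D ≤ 12 * d) :
    CoinBounded d (b / 2 ^ L.length) (fun y => coinE L (fun t => h (y + t))) := by
  obtain ⟨C, hC⟩ := hh.bounded
  refine ⟨div_nonneg hh.nonneg (by positivity), ⟨C, fun x => ?_⟩, fun L' hL' x => ?_⟩
  · simpa [coinE_const] using abs_coinE_le L fun t => hC (x + t)
  · have := hh.le_coinE (L' ++ L) (by
      intro D hD
      rcases List.mem_append.1 hD with h | h
      exacts [hL' D h, hL D h]) x
    rw [coinE_append, List.length_append, add_comm, pow_add, ← div_div] at this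
    simpa only [add_assoc] using this

/-- The law `ν` contains enough independent coins to gain a factor `φ`. -/
def CoinGain (d φ : ℝ) (ν : Measure ℤ) : Prop :=
  ∀ b h, CoinBounded d b h → ∀ x, -(b * φ) ≤ lawAvg ν h x

lemma CoinGain.coinBounded {d φ b : ℝ} {ν : Measure ℤ} [IsProbabilityMeasure ν] (hφ : 0 ≤ φ)
    (hν : CoinGain d φ ν) {h : ℝ → ℝ} (hh : CoinBounded d b h) :
    CoinBounded d (b * φ) (lawAvg ν h) := by
  obtain ⟨C, hC⟩ := hh.bounded
  refine ⟨mul_nonneg hh.nonneg hφ, ⟨C, abs_lawAvg_le ν hC⟩, fun L hL x => ?_⟩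
  rw [coinE_lawAvg ν L hC, mul_div_right_comm]
  exact hν _ _ (hh.coinE hL) x

lemma coinGain_one (d : ℝ) (ν : Measure ℤ) [IsProbabilityMeasure ν] : CoinGain d 1 ν := by
  intro b h hh x
  obtain ⟨C, hC⟩ := hh.bounded
  have : ∫ _ : ℤ, (-b) ∂ν ≤ lawAvg ν h x := by
    refine integral_mono (integrable_const _)
      (integrable_int_of_bounded ν fun k : ℤ => hC (x + k)) fun k => ?_
    simpa [_root_.coinE] using hh.le_coinE [] (by simp) (x + k)
  simpa using this

lemma mconvZ_eq (μ ν : Measure ℤ) [IsProbabilityMeasure μ] [IsProbabilityMeasure ν] :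
    mconvZ μ ν = (μ.prod ν).map (fun p => p.1 + p.2) := by
  ext s hs
  rw [mconvZ, Measure.bind_apply hs (Measurable.of_discrete).aemeasurable,
    Measure.map_apply Measurable.of_discrete hs,
    Measure.prod_apply (Measurable.of_discrete hs)]
  refine lintegral_congr fun x => ?_
  rw [Measure.map_apply Measurable.of_discrete hs]
  rfl

lemma lawAvg_mconvZ (μ ν : Measure ℤ) [IsProbabilityMeasure μ] [IsProbabilityMeasure ν]
    {h : ℝ → ℝ} {C : ℝ} (hC : ∀ x, |h x| ≤ C) (x : ℝ) :
    lawAvg (mconvZ μ ν) h x = lawAvg μ (lawAvg ν h) x := by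
  have hint : Integrable (fun p : ℤ × ℤ => h (x + (p.1 + p.2 : ℤ))) (μ.prod ν) :=
    Integrable.of_bound (Measurable.of_discrete).aestronglyMeasurable C (ae_of_all _ fun p => hC _)
  rw [lawAvg, mconvZ_eq, integral_map (Measurable.of_discrete).aemeasurable
    (Measurable.of_discrete).aestronglyMeasurable, integral_prod _ hint]
  simp only [lawAvg]
  push_cast
  simp only [add_assoc]

instance (μ ν : Measure ℤ) [IsProbabilityMeasure μ] [IsProbabilityMeasure ν] :
    IsProbabilityMeasure (mconvZ μ ν) := by
  rw [mconvZ_eq]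
  exact Measure.isProbabilityMeasure_map (Measurable.of_discrete).aemeasurable

/-- The quicksort recursion in terms of averages of bounded functions. -/
lemma IsQuicksortLaw.lawAvg_eq {μ : ℕ → Measure ℤ} (hμ : IsQuicksortLaw μ) {n : ℕ} (hn : 2 ≤ n)
    {h : ℝ → ℝ} {C : ℝ} (hC : ∀ x, |h x| ≤ C) (x : ℝ) :
    lawAvg (μ n) h x = (∑ u ∈ Finset.Icc 1 n,
      lawAvg (μ (u - 1)) (lawAvg (μ (n - u)) h) (x + (n - 1))) / n := by
  have := hμ.1
  have hm : Measurable fun x : ℤ => x + ((n : ℤ) - 1) := Measurable.of_discrete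
  rw [lawAvg, hμ.2.2.2 n hn, integral_smul_measure, integral_finsetSum_measure, ENNReal.toReal_inv,
    ENNReal.toReal_natCast, smul_eq_mul, inv_mul_eq_div]
  · congr 1
    refine Finset.sum_congr rfl fun u _ => ?_
    rw [integral_map hm.aemeasurable (Measurable.of_discrete).aestronglyMeasurable,
      ← lawAvg_mconvZ _ _ hC, lawAvg]
    refine integral_congr_ae (ae_of_all _ fun k => ?_)
    push_cast
    congr 1; ring
  · intro u _
    have := Measure.isProbabilityMeasure_map (μ := mconvZ (μ (u - 1)) (μ (n - u))) hm.aemeasurable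
    exact integrable_int_of_bounded _ fun k => hC _

lemma lawAvg_mono (ν : Measure ℤ) [IsProbabilityMeasure ν] {g h : ℝ → ℝ} {C C' : ℝ}
    (hg : ∀ x, |g x| ≤ C) (hh : ∀ x, |h x| ≤ C') (hgh : ∀ x, g x ≤ h x) (x : ℝ) :
    lawAvg ν g x ≤ lawAvg ν h x :=
  integral_mono (integrable_int_of_bounded ν fun k : ℤ => hg (x + k))
    (integrable_int_of_bounded ν fun k : ℤ => hh (x + k)) fun k => hgh (x + k)

lemma lawAvg_nonneg (ν : Measure ℤ) {h : ℝ → ℝ} (hh : ∀ x, 0 ≤ h x) (x : ℝ) : 0 ≤ lawAvg ν h x :=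
  integral_nonneg fun k => hh (x + k)

lemma lawAvg_sum_div (ν : Measure ℤ) [IsProbabilityMeasure ν] {ι : Type*} (S : Finset ι)
    {F : ι → ℝ → ℝ} {C : ℝ} (hF : ∀ i x, |F i x| ≤ C) (c N x : ℝ) :
    lawAvg ν (fun y => (∑ i ∈ S, F i (y + c)) / N) x = (∑ i ∈ S, lawAvg ν (F i) (x + c)) / N := by
  simp only [lawAvg]
  rw [integral_div, integral_finsetSum]
  · simp only [add_right_comm]
  · exact fun i _ => integrable_int_of_bounded ν fun k => hF i (x + k + c)

lemma le_lawAvg_add_lawAvg (ν : Measure ℤ) [IsProbabilityMeasure ν] {h : ℝ → ℝ} {C b D : ℝ}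
    (hC : ∀ x, |h x| ≤ C) (hh : ∀ x, b ≤ h (x - D) + h (x + D)) (x : ℝ) :
    b ≤ lawAvg ν h (x - D) + lawAvg ν h (x + D) := by
  have h1 := integrable_int_of_bounded ν fun k : ℤ => hC (x - D + k)
  have h2 := integrable_int_of_bounded ν fun k : ℤ => hC (x + D + k)
  rw [lawAvg, lawAvg, ← integral_add h1 h2]
  have : ∫ _ : ℤ, b ∂ν ≤ ∫ k : ℤ, (h (x - D + k) + h (x + D + k)) ∂ν := by
    refine integral_mono (integrable_const _) (h1.add h2) fun k => ?_
    have := hh (x + k)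
    rwa [add_sub_right_comm, add_right_comm] at this
  simpa using this

/-- Lower bound for averages of nonnegative functions from part of the quicksort recursion. -/
lemma IsQuicksortLaw.sum_le_lawAvg {μ : ℕ → Measure ℤ} (hμ : IsQuicksortLaw μ) {n N : ℕ}
    (hn : 2 ≤ n) (hN : n ≤ N) {h : ℝ → ℝ} {C : ℝ} (hC : ∀ x, |h x| ≤ C) (hh : ∀ x, 0 ≤ h x)
    (S : Finset ℕ) {u : ℕ → ℕ} (hu : ∀ i ∈ S, 1 ≤ u i ∧ u i ≤ n) (hinj : Set.InjOn u S) (x : ℝ) :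
    (∑ i ∈ S, lawAvg (μ (u i - 1)) (lawAvg (μ (n - u i)) h) (x + (n - 1))) / N
      ≤ lawAvg (μ n) h x := by
  rw [hμ.lawAvg_eq hn hC]
  have hpos : ∀ v, 0 ≤ lawAvg (μ (v - 1)) (lawAvg (μ (n - v)) h) (x + (n - 1)) :=
    fun v => lawAvg_nonneg _ (lawAvg_nonneg _ hh) _
  rw [← Finset.sum_image
    (f := fun v => lawAvg (μ (v - 1)) (lawAvg (μ (n - v)) h) (x + (n - 1))) hinj]
  refine div_le_div₀ (Finset.sum_nonneg fun v _ => hpos v)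
    (Finset.sum_le_sum_of_subset_of_nonneg ?_ fun v _ _ => hpos v) (by positivity)
    (by exact_mod_cast hN)
  intro v hv
  obtain ⟨i, hi, rfl⟩ := Finset.mem_image.1 hv
  exact Finset.mem_Icc.2 (hu i hi)

/-- One fair coin is visible in the first two pivots: exchanging the roles of the pivots `i` and
`j` with `i ≤ s / 4 < j ≤ s / 2` shifts the cost by `s + 1 - i - j`. -/
lemma IsQuicksortLaw.div_le_lawAvg {μ : ℕ → Measure ℤ} (hμ : IsQuicksortLaw μ) {s : ℕ}
    (hs : 8 ≤ s) {h : ℝ → ℝ} {b C : ℝ} (hb : 0 ≤ b) (hC : ∀ x, |h x| ≤ C) (hh : ∀ x, 0 ≤ h x)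
    (hD : ∀ D : ℝ, s / 8 ≤ D → D ≤ s / 2 → ∀ x, b ≤ h (x - D) + h (x + D)) (x : ℝ) :
    b / 64 ≤ lawAvg (μ s) h x := by
  have := hμ.1
  set I := Finset.Icc 1 (s / 4)
  set J := Finset.Ioc (s / 4) (s / 2)
  set A : ℕ → ℕ → ℝ → ℝ := fun i j =>
    lawAvg (μ (i - 1)) (lawAvg (μ (j - i - 1)) (lawAvg (μ (s - j)) h))
  have hA : ∀ i j y, |A i j y| ≤ C :=
    fun i j => abs_lawAvg_le _ (abs_lawAvg_le _ (abs_lawAvg_le _ hC))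
  have hI : ∀ i ∈ I, 1 ≤ i ∧ i ≤ s / 4 := fun i hi => Finset.mem_Icc.1 hi
  have hJ : ∀ j ∈ J, s / 4 < j ∧ j ≤ s / 2 := fun j hj => Finset.mem_Ioc.1 hj
  have hTI : ∀ i ∈ I, (∑ j ∈ J, A i j (x + (s - 1) + (s - i - 1))) / s ≤
      lawAvg (μ (i - 1)) (lawAvg (μ (s - i)) h) (x + (s - 1)) := by
    intro i hi
    have hi' := hI i hi
    rw [← lawAvg_sum_div (μ (i - 1)) J
      (F := fun j => lawAvg (μ (j - i - 1)) (lawAvg (μ (s - j)) h))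
      fun j => abs_lawAvg_le _ (abs_lawAvg_le _ hC)]
    refine lawAvg_mono _ (C := J.card * C / s) (C' := C) (fun y => ?_) (abs_lawAvg_le _ hC)
      (fun y => ?_) _
    · rw [abs_div, Nat.abs_cast]
      gcongr
      refine (Finset.abs_sum_le_sum_abs _ _).trans ?_
      rw [← nsmul_eq_mul]
      exact Finset.sum_le_card_nsmul _ _ _ fun j _ => abs_lawAvg_le _ (abs_lawAvg_le _ hC) _
    · have key := hμ.sum_le_lawAvg (n := s - i) (N := s) (by omega) (by omega) hC hh J
        (u := fun j => j - i) (fun j hj => by have := hJ j hj; omega)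
        (fun j hj j' hj' hjj => by
          have := hJ j hj; have := hJ j' hj'; simp only at hjj; omega) y
      rw [Nat.cast_sub (by omega)] at key
      refine le_trans (le_of_eq ?_) key
      congr 1
      refine Finset.sum_congr rfl fun j hj => ?_
      have := hJ j hj
      rw [show s - i - (j - i) = s - j by omega]
  have hTJ : ∀ j ∈ J, (∑ i ∈ I, A i j (x + (s - 1) + (j - 1 - 1))) / s ≤
      lawAvg (μ (j - 1)) (lawAvg (μ (s - j)) h) (x + (s - 1)) := by
    intro j hj
    have hj' := hJ j hj
    have key := hμ.sum_le_lawAvg (n := j - 1) (N := s) (by omega) (by omega)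
      (abs_lawAvg_le (μ (s - j)) hC) (lawAvg_nonneg (μ (s - j)) hh) I
      (u := id) (fun i hi => by have := hI i hi; simp only [id]; omega)
      (Set.injOn_id _) (x + (s - 1))
    rw [Nat.cast_sub (by omega)] at key
    refine le_trans (le_of_eq ?_) key
    congr 1
    refine Finset.sum_congr rfl fun i _ => ?_
    simp only [A, id, Nat.cast_one, Nat.sub_right_comm j 1 i]
  have hpair : ∀ i ∈ I, ∀ j ∈ J,
      b ≤ A i j (x + (s - 1) + (s - i - 1)) + A i j (x + (s - 1) + (j - 1 - 1)) := by
    intro i hi j hj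
    have hi' := hI i hi
    have hj' := hJ j hj
    have h1 : (1 : ℝ) ≤ i := by exact_mod_cast hi'.1
    have h2 : (4 * i : ℝ) ≤ s := by exact_mod_cast (show 4 * i ≤ s by omega)
    have h3 : (2 * j : ℝ) ≤ s := by exact_mod_cast (show 2 * j ≤ s by omega)
    have h4 : (0 : ℝ) ≤ j := by positivity
    set D : ℝ := (s + 1 - i - j) / 2 with hDdef
    have hpt := le_lawAvg_add_lawAvg (μ (i - 1)) (abs_lawAvg_le _ (abs_lawAvg_le _ hC))
      (le_lawAvg_add_lawAvg (μ (j - i - 1)) (abs_lawAvg_le _ hC)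
      (le_lawAvg_add_lawAvg (μ (s - j)) hC (hD D (by linarith) (by linarith))))
      (x + (s - 1) + (s - i - 1) - D)
    rw [add_comm]
    convert hpt using 3
    · rw [hDdef]; ring
    · ring
  have hdisj : Disjoint I J := Finset.disjoint_left.2 fun i hi hj => by
    have := hI i hi; have := hJ i hj; omega
  have hcard : (s : ℝ) ^ 2 / 64 ≤ (I.card : ℝ) * J.card := by
    have h1 : s ≤ 8 * I.card := by simp only [I, Nat.card_Icc]; omega
    have h2 : s ≤ 8 * J.card := by simp only [J, Nat.card_Ioc]; omega
    have h1' : (s : ℝ) ≤ 8 * I.card := by exact_mod_cast h1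
    have h2' : (s : ℝ) ≤ 8 * J.card := by exact_mod_cast h2
    nlinarith [mul_le_mul h1' h2' (by positivity) (by positivity)]
  have hs0 : (0 : ℝ) < s := by exact_mod_cast (show 0 < s by omega)
  have hmain := hμ.sum_le_lawAvg (n := s) (N := s) (by omega) le_rfl hC hh (I ∪ J) (u := id)
    (fun i hi => by
      rcases Finset.mem_union.1 hi with hi | hi
      · have := hI i hi; simp only [id]; omega
      · have := hJ i hi; simp only [id]; omega) (Set.injOn_id _) x
  refine le_trans ?_ hmain
  rw [Finset.sum_union hdisj, le_div_iff₀ hs0]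
  refine le_trans ?_ (add_le_add (Finset.sum_le_sum hTI) (Finset.sum_le_sum hTJ))
  rw [← Finset.sum_div, ← Finset.sum_div, Finset.sum_comm (s := J), ← add_div,
    ← Finset.sum_add_distrib, le_div_iff₀ hs0]
  calc b / 64 * s * s = b * (s ^ 2 / 64) := by ring
    _ ≤ b * (I.card * J.card) := by gcongr
    _ = ∑ i ∈ I, ∑ j ∈ J, b := by simp; ring
    _ ≤ ∑ i ∈ I, ∑ j ∈ J, (A i j (x + (s - 1) + (s - i - 1)) +
          A i j (x + (s - 1) + (j - 1 - 1))) :=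
        Finset.sum_le_sum fun i hi => Finset.sum_le_sum fun j hj => hpair i hi j hj
    _ = _ := Finset.sum_congr rfl fun i _ => Finset.sum_add_distrib

lemma IsQuicksortLaw.coinGain_base {μ : ℕ → Measure ℤ} (hμ : IsQuicksortLaw μ) {R s : ℕ}
    (hR : 8 ≤ R) (hRs : R ≤ s) (hsR : s ≤ 3 * R) : CoinGain (R / 8) (1 - 1 / 64) (μ s) := by
  intro b h hh x
  have := hμ.1
  obtain ⟨C, hC⟩ := hh.bounded
  have h1 : (R : ℝ) ≤ s := by exact_mod_cast hRs
  have h2 : (s : ℝ) ≤ 3 * R := by exact_mod_cast hsR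
  have key := hμ.div_le_lawAvg (hR.trans hRs) (h := fun y => h y + b) (C := C + b) hh.nonneg
    (fun y => (abs_add_le _ _).trans (by rw [abs_of_nonneg hh.nonneg]; linarith [hC y]))
    (fun y => by
      have := hh.le_coinE [] (by simp) y
      simp [_root_.coinE] at this; linarith)
    (fun D hD1 hD2 y => by
      have := hh.le_coinE [D] (by simp; constructor <;> linarith) y
      simp [_root_.coinE, ← sub_eq_add_neg] at this; linarith) x
  rw [lawAvg, integral_add (integrable_int_of_bounded _ fun k : ℤ => hC (x + k))
    (integrable_const _)] at key
  simp at key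
  simp only [lawAvg]
  linarith

lemma CoinGain.mono {d φ φ' : ℝ} {ν : Measure ℤ} (h : CoinGain d φ ν) (hφ : φ ≤ φ') :
    CoinGain d φ' ν := fun b g hg x =>
  (neg_le_neg (mul_le_mul_of_nonneg_left hφ hg.nonneg)).trans (h b g hg x)

/-- The factor gained from the coins hidden in a quicksort run on `n` keys, at scale `R`. -/
noncomputable def gainFactor (R n : ℕ) : ℝ :=
  if n < R then 1 else Real.exp (-((n + 1) / (512 * R)) - 1 / 128)

lemma gainFactor_pos (R n : ℕ) : 0 < gainFactor R n := by
  unfold gainFactor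
  split_ifs
  exacts [one_pos, Real.exp_pos _]

lemma gainFactor_mul_le {R n u : ℕ} (hR : 0 < R) (hn : 3 * R < n) (hu1 : 1 ≤ u) (hun : u ≤ n) :
    gainFactor R (u - 1) * gainFactor R (n - u) ≤ gainFactor R n * (128 / 129 +
      ((if u ≤ R then 1 / 100 else 0) + (if n - R < u then 1 / 100 else 0))) := by
  have hR' : (0 : ℝ) < R := by exact_mod_cast hR
  have hα : Real.exp (1 / 512) ≤ 512 / 511 := by
    have := Real.add_one_le_exp (-(1 / 512) : ℝ)
    rw [Real.exp_neg] at this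
    have h2 := inv_anti₀ (by norm_num) this
    rw [inv_inv] at h2
    exact h2.trans (by norm_num)
  have hβ : Real.exp (-(1 / 128)) ≤ 128 / 129 := by
    have := Real.add_one_le_exp (1 / 128 : ℝ)
    rw [Real.exp_neg]
    exact (inv_anti₀ (by norm_num) this).trans (by norm_num)
  have hΦ : gainFactor R n = Real.exp (-((n + 1) / (512 * R)) - 1 / 128) := by
    rw [gainFactor, if_neg (by omega)]
  have hpos := gainFactor_pos R n
  by_cases h1 : u ≤ R
  · have h2 : ¬ n - R < u := by omega
    have : gainFactor R (u - 1) * gainFactor R (n - u) ≤ gainFactor R n * Real.exp (1 / 512) := by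
      rw [hΦ, gainFactor, if_pos (by omega), one_mul, gainFactor, if_neg (by omega),
        ← Real.exp_add, Nat.cast_sub hun]
      refine Real.exp_le_exp.2 ?_
      have h3 : (u : ℝ) / (512 * R) ≤ 1 / 512 := by
        rw [div_le_div_iff₀ (by positivity) (by norm_num)]
        have : (u : ℝ) ≤ R := by exact_mod_cast h1
        linarith
      have h4 : ((n - u + 1 : ℝ)) / (512 * R) = (n + 1) / (512 * R) - u / (512 * R) := by ring
      rw [h4]; linarith
    rw [if_pos h1, if_neg h2]
    exact this.trans (mul_le_mul_of_nonneg_left (hα.trans (by norm_num)) hpos.le)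
  · by_cases h2 : n - R < u
    · have : gainFactor R (u - 1) * gainFactor R (n - u) ≤
          gainFactor R n * Real.exp (1 / 512) := by
        rw [hΦ, gainFactor, if_neg (by omega), gainFactor, if_pos (by omega), mul_one,
          ← Real.exp_add, Nat.cast_sub hu1]
        refine Real.exp_le_exp.2 ?_
        have h3 : (n + 1 - u : ℝ) / (512 * R) ≤ 1 / 512 := by
          rw [div_le_div_iff₀ (by positivity) (by norm_num)]
          have : (n + 1 : ℝ) ≤ R + u := by exact_mod_cast (by omega : n + 1 ≤ R + u)
          linarith
        have h4 : (((u : ℝ) - (1 : ℕ) + 1 : ℝ)) / (512 * R) =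
            (n + 1) / (512 * R) - (n + 1 - u) / (512 * R) := by push_cast; ring
        rw [h4]; linarith
      rw [if_neg h1, if_pos h2]
      exact this.trans (mul_le_mul_of_nonneg_left (hα.trans (by norm_num)) hpos.le)
    · rw [if_neg h1, if_neg h2, add_zero, add_zero]
      refine le_trans (le_of_eq ?_) (mul_le_mul_of_nonneg_left hβ hpos.le)
      rw [hΦ, gainFactor, if_neg (by omega), gainFactor, if_neg (by omega), ← Real.exp_add,
        ← Real.exp_add, Nat.cast_sub hun, Nat.cast_sub hu1]
      congr 1
      push_cast
      ring

lemma sum_gainFactor_mul_le {R n : ℕ} (hR : 0 < R) (hn : 3 * R < n) :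
    ∑ u ∈ Finset.Icc 1 n, gainFactor R (u - 1) * gainFactor R (n - u) ≤ gainFactor R n * n := by
  have hpos := gainFactor_pos R n
  have hn' : (3 * R : ℝ) ≤ n := by exact_mod_cast hn.le
  refine (Finset.sum_le_sum fun u hu => gainFactor_mul_le hR hn (Finset.mem_Icc.1 hu).1
    (Finset.mem_Icc.1 hu).2).trans ?_
  rw [← Finset.mul_sum]
  refine mul_le_mul_of_nonneg_left ?_ hpos.le
  have h1 : (Finset.Icc 1 n).filter (fun u => u ≤ R) ⊆ Finset.Icc 1 R := fun u hu => by
    simp only [Finset.mem_filter, Finset.mem_Icc] at hu ⊢; omega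
  have h2 : (Finset.Icc 1 n).filter (fun u => n - R < u) ⊆ Finset.Ioc (n - R) n := fun u hu => by
    simp only [Finset.mem_filter, Finset.mem_Icc, Finset.mem_Ioc] at hu ⊢; omega
  have h1' : (((Finset.Icc 1 n).filter fun u => u ≤ R).card : ℝ) ≤ R := by
    exact_mod_cast (Finset.card_le_card h1).trans (by simp)
  have h2' : (((Finset.Icc 1 n).filter fun u => n - R < u).card : ℝ) ≤ R := by
    exact_mod_cast (Finset.card_le_card h2).trans (by simp; omega)
  rw [Finset.sum_add_distrib, Finset.sum_add_distrib, ← Finset.sum_filter, ← Finset.sum_filter]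
  simp only [Finset.sum_const, nsmul_eq_mul, Nat.card_Icc, Nat.add_sub_cancel]
  linarith

theorem IsQuicksortLaw.coinGain {μ : ℕ → Measure ℤ} (hμ : IsQuicksortLaw μ) {R : ℕ} (hR : 8 ≤ R)
    (n : ℕ) : CoinGain (R / 8) (gainFactor R n) (μ n) := by
  have := hμ.1
  have hR' : (0 : ℝ) < R := by exact_mod_cast (by omega : 0 < R)
  induction n using Nat.strong_induction_on with
  | _ n ih =>
    by_cases h1 : n < R
    · rw [gainFactor, if_pos h1]
      exact coinGain_one _ _
    by_cases h2 : n ≤ 3 * R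
    · refine (hμ.coinGain_base hR (not_lt.1 h1) h2).mono ?_
      rw [gainFactor, if_neg h1]
      have h3 : ((n : ℝ) + 1) / (512 * R) ≤ 1 / 128 := by
        rw [div_le_div_iff₀ (by positivity) (by norm_num)]
        have : (n + 1 : ℝ) ≤ 4 * R := by exact_mod_cast (by omega : n + 1 ≤ 4 * R)
        linarith
      linarith [Real.add_one_le_exp (-((n + 1) / (512 * R)) - 1 / 128 : ℝ)]
    · push Not at h2
      intro b h hh x
      obtain ⟨C, hC⟩ := hh.bounded
      have hn : (0 : ℝ) < n := by exact_mod_cast (by omega : 0 < n)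
      rw [hμ.lawAvg_eq (by omega) hC, le_div_iff₀ hn]
      have key : ∀ u ∈ Finset.Icc 1 n, -(b * (gainFactor R (u - 1) * gainFactor R (n - u))) ≤
          lawAvg (μ (u - 1)) (lawAvg (μ (n - u)) h) (x + (n - 1)) := by
        intro u hu
        rw [Finset.mem_Icc] at hu
        have h3 := ih (u - 1) (by omega) _ _
          ((ih (n - u) (by omega)).coinBounded (gainFactor_pos _ _).le hh) (x + (n - 1))
        rwa [mul_assoc, mul_comm (gainFactor R (n - u))] at h3
      refine le_trans ?_ (Finset.sum_le_sum key)
      rw [Finset.sum_neg_distrib, ← Finset.mul_sum, neg_mul, mul_assoc]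
      exact neg_le_neg (mul_le_mul_of_nonneg_left
        (sum_gainFactor_mul_le (by omega) h2) hh.nonneg)

lemma coinBounded_bump_add {d σ η : ℝ} {N : ℕ} {G : ℝ → ℝ} (hd : 0 ≤ d) (hσ : 0 < σ)
    (hη : 0 ≤ η) (hG : ∀ x, |G x| ≤ 1) (hN : N * (12 * d) ^ 2 ≤ σ ^ 2)
    (hcoin : ∀ L : List ℝ, L.length = N → (∀ D ∈ L, d ≤ D ∧ D ≤ 12 * d) → ∀ x,
      |coinE L (fun t => G (x + t))| ≤ η * bump σ x) :
    CoinBounded d (2 ^ N) (fun z => 2 * η * bump σ z + G z) := by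
  have hlow : ∀ z, -1 ≤ 2 * η * bump σ z + G z := fun z => by
    have := (abs_le.1 (hG z)).1
    have := mul_nonneg (mul_nonneg zero_le_two hη) (bump_pos σ z).le
    linarith
  refine ⟨by positivity, ⟨2 * η + 1, fun x => ?_⟩, fun L hL x => ?_⟩
  · refine (abs_add_le _ _).trans (add_le_add ?_ (hG x))
    rw [abs_of_nonneg (by have := (bump_pos σ x).le; positivity)]
    exact mul_le_of_le_one_right (by positivity) (bump_le_one σ x)
  · rcases lt_or_ge L.length N with h | h
    · have h1 : (1 : ℝ) ≤ 2 ^ N / 2 ^ L.length := by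
        rw [one_le_div (by positivity)]
        exact pow_le_pow_right₀ one_le_two h.le
      have h2 := coinE_mono L fun t => hlow (x + t)
      rw [coinE_const] at h2
      linarith
    · have h1 : 0 ≤ coinE L (fun t => 2 * η * bump σ (x + t) + G (x + t)) := by
        rw [← List.take_append_drop (L.length - N) L, coinE_append]
        refine coinE_nonneg _ fun u => ?_
        set L' := L.drop (L.length - N)
        have hlen : L'.length = N := by simp only [L', List.length_drop]; omega
        have hL' : ∀ D ∈ L', d ≤ D ∧ D ≤ 12 * d := fun D hD => hL D (List.mem_of_mem_drop hD)
        have h2 := hcoin L' hlen hL' (x + u)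
        have h3 := bump_le_coinE hσ (L := L') (by
          refine (sum_sq_le fun D hD => ⟨hd.trans (hL' D hD).1, (hL' D hD).2⟩).trans ?_
          rwa [hlen]) (x + u)
        simp only [← add_assoc]
        rw [coinE_add, coinE_const_mul]
        have := mul_le_mul_of_nonneg_left h3 hη
        linarith [(abs_le.1 h2).1]
      exact (neg_nonpos.2 (by positivity)).trans h1

lemma bump_eq_comp_div (σ z : ℝ) : bump σ z = (1 + (z / σ) ^ 2)⁻¹ := by rw [bump, div_pow]

lemma integrable_bump {σ : ℝ} (hσ : 0 < σ) : Integrable (bump σ) := by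
  rw [funext (bump_eq_comp_div σ)]
  exact integrable_inv_one_add_sq.comp_div hσ.ne'

lemma integral_bump {σ : ℝ} (hσ : 0 < σ) : ∫ z, bump σ z = σ * Real.pi := by
  simp only [bump_eq_comp_div]
  rw [Measure.integral_comp_div (fun z : ℝ => (1 + z ^ 2)⁻¹), integral_univ_inv_one_add_sq,
    abs_of_pos hσ, smul_eq_mul]

lemma mul_bump_le_integral {σ m : ℝ} (hσ : 0 < σ) (hm : 0 < m) (hmσ : m ≤ σ) (y : ℝ) :
    m * bump σ y ≤ 4 * ∫ z, (Set.Ico (y - m) y).indicator (bump σ) z := by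
  have h : ∫ _ in Set.Ico (y - m) y, bump σ y / 4 ≤ ∫ z in Set.Ico (y - m) y, bump σ z := by
    refine setIntegral_mono_on (by simp) (integrable_bump hσ).integrableOn measurableSet_Ico
      fun z hz => ?_
    have h1 := bump_le_add σ y (z - y)
    rw [add_sub_cancel] at h1
    have h2 : (z - y) ^ 2 / σ ^ 2 ≤ 1 := by
      rw [div_le_one (by positivity)]
      exact sq_le_sq' (by linarith [hz.1]) (by linarith [hz.2])
    nlinarith [bump_pos σ z]
  rw [integral_indicator measurableSet_Ico]
  simp [Measure.real] at h
  rw [ENNReal.toReal_ofReal hm.le] at h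
  linarith

/-- A law spread out at scale `m` gives small mass to bumps of width `σ ≥ m`. -/
lemma lawAvg_bump_le (ν : Measure ℤ) [IsProbabilityMeasure ν] {σ m κ : ℝ} (hσ : 0 < σ)
    (hm : 0 < m) (hmσ : m ≤ σ)
    (hν : ∀ a : ℝ, ν.real {k : ℤ | (k : ℝ) ∈ Set.Ioc a (a + m)} ≤ κ * m) (x : ℝ) :
    lawAvg ν (bump σ) x ≤ 4 * Real.pi * κ * σ := by
  set F : ℤ → ℝ → ℝ := fun k z => (Set.Ico (x + k - m) (x + k)).indicator (bump σ) z
  have hint : Integrable (Function.uncurry F) (ν.prod volume) := by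
    have h1 : Integrable (fun p : ℤ × ℝ => bump σ p.2) (ν.prod volume) :=
      (integrable_bump hσ).comp_snd ν
    have h2 : MeasurableSet {p : ℤ × ℝ | x + p.1 - m ≤ p.2 ∧ p.2 < x + p.1} := by
      have h3 : Measurable fun p : ℤ × ℝ => x + (p.1 : ℝ) :=
        measurable_const.add ((Measurable.of_discrete (f := fun k : ℤ => (k : ℝ))).comp
          measurable_fst)
      exact (measurableSet_le (h3.sub_const m) measurable_snd).inter
        (measurableSet_lt measurable_snd h3)
    exact h1.indicator h2
  have hpt : ∀ k : ℤ, m * bump σ (x + k) ≤ 4 * ∫ z, F k z :=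
    fun k => mul_bump_le_integral hσ hm hmσ (x + k)
  have hb : Integrable (fun k : ℤ => bump σ (x + k)) ν :=
    integrable_int_of_bounded ν (C := 1) fun k => by
      rw [abs_of_pos (bump_pos _ _)]; exact bump_le_one _ _
  have h1 : m * lawAvg ν (bump σ) x ≤ 4 * ∫ k, (∫ z, F k z) ∂ν := by
    rw [lawAvg, ← integral_const_mul, ← integral_const_mul]
    exact integral_mono (hb.const_mul m) (hint.integral_prod_left.const_mul 4) hpt
  rw [integral_integral_swap hint] at h1
  have h2 : ∫ z, ∫ k, F k z ∂ν ≤ ∫ z, bump σ z * (κ * m) := by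
    refine integral_mono hint.integral_prod_right ((integrable_bump hσ).mul_const _) fun z => ?_
    have h3 : ∀ k : ℤ, F k z =
        {k : ℤ | (k : ℝ) ∈ Set.Ioc (z - x) (z - x + m)}.indicator (fun _ => bump σ z) k := by
      intro k
      simp only [F, Set.indicator_apply, Set.mem_Ico, Set.mem_ofPred_eq, Set.mem_Ioc]
      congr 1
      apply propext
      constructor <;> rintro ⟨h, h'⟩ <;> constructor <;> linarith
    simp only [h3]
    rw [integral_indicator_const _ (MeasurableSet.of_discrete), smul_eq_mul, mul_comm]
    exact mul_le_mul_of_nonneg_left (hν _) (bump_pos σ z).le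
  rw [integral_mul_const, integral_bump hσ] at h2
  refine le_of_mul_le_mul_left ?_ hm
  linarith

lemma lawAvg_indicator (ν : Measure ℤ) (ℓ a : ℝ) :
    lawAvg ν ((Set.Ioc 0 ℓ).indicator 1) (-a) =
      ν.real {k : ℤ | (k : ℝ) ∈ Set.Ioc a (a + ℓ)} := by
  rw [lawAvg, ← integral_indicator_one MeasurableSet.of_discrete]
  congr 1
  ext k
  simp only [Set.indicator_apply, Set.mem_Ioc, Set.mem_ofPred_eq, Pi.one_apply]
  congr 1
  apply propext
  constructor <;> rintro ⟨h, h'⟩ <;> constructor <;> linarith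

lemma abs_indicator_one_sub_le (S : Set ℝ) (y z : ℝ) :
    |S.indicator (1 : ℝ → ℝ) y - S.indicator (1 : ℝ → ℝ) z| ≤ 1 := by
  by_cases hy : y ∈ S <;> by_cases hz : z ∈ S <;> simp [hy, hz]

/-- The law of the quicksort cost gives nearly the same mass to nearby intervals. -/
theorem IsQuicksortLaw.abs_real_Ioc_sub_le {μ : ℕ → Measure ℤ} (hμ : IsQuicksortLaw μ)
    {n R K : ℕ} (hR : 8 ≤ R) (hK : 1 ≤ K) {σ m κ ℓ s : ℝ} (hσ : 864 * K * (R / 8) ^ 2 ≤ σ ^ 2)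
    (hσ0 : 0 < σ) (hRℓ : R / 8 ≤ ℓ) (hℓs : ℓ ≤ s) (hsσ : s ≤ σ) (hRσ : 24 * (R / 8) ≤ σ)
    (hm : 0 < m) (hmσ : m ≤ σ)
    (hν : ∀ a : ℝ, (μ n).real {k : ℤ | (k : ℝ) ∈ Set.Ioc a (a + m)} ≤ κ * m) (a : ℝ) :
    |(μ n).real {k : ℤ | (k : ℝ) ∈ Set.Ioc (a + s) (a + s + ℓ)} -
      (μ n).real {k : ℤ | (k : ℝ) ∈ Set.Ioc a (a + ℓ)}| ≤
    2 * (10 ^ 5 / √(2 * K + 1) + 10 ^ 5 * (ℓ * s) / ((R / 8) ^ 2 * (2 * K + 1))) *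
      (4 * Real.pi * κ * σ) + 2 ^ (6 * K) * gainFactor R n := by
  have := hμ.1 n
  set η := 10 ^ 5 / √(2 * K + 1) + 10 ^ 5 * (ℓ * s) / ((R / 8) ^ 2 * (2 * K + 1)) with hηdef
  have hd : (0 : ℝ) < R / 8 := by
    have : (0 : ℝ) < R := by exact_mod_cast (by omega : 0 < R)
    positivity
  have hℓ : 0 < ℓ := hd.trans_le hRℓ
  have hη : 0 ≤ η := by have := hℓ.le.trans hℓs; positivity
  set G : ℝ → ℝ := fun z =>
    (Set.Ioc 0 ℓ).indicator (1 : ℝ → ℝ) z - (Set.Ioc 0 ℓ).indicator (1 : ℝ → ℝ) (z + s) with hGdef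
  have hG : ∀ z, |G z| ≤ 1 := fun z => abs_indicator_one_sub_le _ _ _
  have hcoin : ∀ L : List ℝ, L.length = 6 * K → (∀ D ∈ L, (R / 8 : ℝ) ≤ D ∧ D ≤ 12 * (R / 8)) →
      ∀ x, |coinE L (fun t => G (x + t))| ≤ η * bump σ x := by
    intro L hlen hL x
    have hσ' : 288 * K * (R / 8 : ℝ) ^ 2 ≤ σ ^ 2 := by
      nlinarith [mul_nonneg (Nat.cast_nonneg (α := ℝ) K) (sq_nonneg (R / 8 : ℝ))]
    have := abs_coinE_indicator_sub_le hK hd hσ' hσ0 hRℓ hℓs hsσ hRσ hlen hL x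
    rw [hGdef, coinE_sub]
    simpa only [add_right_comm] using this
  have hN : (Nat.cast (6 * K) : ℝ) * (12 * (R / 8)) ^ 2 ≤ σ ^ 2 := by push_cast; linarith
  have hb1 : ∀ k : ℤ, |bump σ (-(a + s) + k)| ≤ 1 := fun k => by
    rw [abs_of_pos (bump_pos _ _)]; exact bump_le_one _ _
  have hi1 := (integrable_int_of_bounded (μ n) hb1).const_mul (2 * η)
  have hi2 := integrable_int_of_bounded (μ n) fun k : ℤ => hG (-(a + s) + k)
  have hbump := mul_le_mul_of_nonneg_left (lawAvg_bump_le (μ n) hσ0 hm hmσ hν (-(a + s)))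
    (mul_nonneg zero_le_two hη)
  have hlaw : lawAvg (μ n) G (-(a + s)) =
      (μ n).real {k : ℤ | (k : ℝ) ∈ Set.Ioc (a + s) (a + s + ℓ)} -
      (μ n).real {k : ℤ | (k : ℝ) ∈ Set.Ioc a (a + ℓ)} := by
    rw [← lawAvg_indicator, ← lawAvg_indicator]
    have hi : ∀ x, ∀ k : ℤ, |(Set.Ioc 0 ℓ).indicator (1 : ℝ → ℝ) (x + k)| ≤ 1 := fun x k => by
      by_cases h : x + k ∈ Set.Ioc 0 ℓ <;> simp [h]
    simp only [lawAvg]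
    rw [← integral_sub (integrable_int_of_bounded _ (hi _)) (integrable_int_of_bounded _ (hi _))]
    simp only [hGdef]
    refine integral_congr_ae (ae_of_all _ fun k => ?_)
    simp only
    rw [show -(a + s) + (k : ℝ) + s = -a + k by ring]
  rw [← hlaw, abs_le]
  constructor
  · have h1 := hμ.coinGain hR n _ _ (coinBounded_bump_add hd.le hσ0 hη hG hN hcoin) (-(a + s))
    rw [lawAvg, integral_add hi1 hi2, integral_const_mul] at h1
    simp only [lawAvg] at hbump ⊢
    linarith
  · have h1 := hμ.coinGain hR n _ _ (coinBounded_bump_add hd.le hσ0 hη (G := fun z => -G z)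
      (fun z => by rw [abs_neg]; exact hG z) hN (fun L hlen hL x => by
        have := coinE_const_mul L (-1) (fun t => G (x + t))
        simp only [neg_one_mul] at this
        rw [this, abs_neg]; exact hcoin L hlen hL x)) (-(a + s))
    have hi3 : Integrable (fun k : ℤ => -G (-(a + s) + k)) (μ n) := hi2.neg
    rw [lawAvg, integral_add hi1 hi3, integral_const_mul, integral_neg] at h1
    simp only [lawAvg] at hbump ⊢
    linarith

lemma two_pow_mul_gainFactor_le {R n K : ℕ} {r : ℝ} (hr : 0 < r) (hR : 0 < R) (hRr : R ≤ r)
    (hn : R ≤ n) (hK : 6144 * r * K ≤ n) :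
    2 ^ (6 * K) * gainFactor R n ≤ Real.exp (-(n / (1024 * r))) := by
  have hR' : (0 : ℝ) < R := by exact_mod_cast hR
  have h2 : (2 : ℝ) ^ (6 * K) ≤ Real.exp (6 * K : ℕ) := by
    rw [← Real.exp_one_pow]
    exact pow_le_pow_left₀ zero_le_two (by linarith [Real.add_one_le_exp 1]) _
  have h3 : (n : ℝ) / (512 * r) ≤ (n + 1) / (512 * R) := by gcongr; linarith
  have h4 : ((6 * K : ℕ) : ℝ) ≤ n / (1024 * r) := by
    rw [le_div_iff₀ (by positivity)]
    push_cast
    linarith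
  rw [gainFactor, if_neg (by omega)]
  refine (mul_le_mul_of_nonneg_right h2 (Real.exp_pos _).le).trans ?_
  rw [← Real.exp_add]
  refine Real.exp_le_exp.2 ?_
  have h5 : (n : ℝ) / (512 * r) = n / (1024 * r) + n / (1024 * r) := by field_simp; ring
  linarith

/-- The comparison of nearby intervals, with a real scale `r` and explicit error terms. -/
theorem IsQuicksortLaw.abs_real_Ioc_sub_le_of_scale {μ : ℕ → Measure ℤ} (hμ : IsQuicksortLaw μ)
    {n : ℕ} {r m ℓ s Γ : ℝ} (hr : 16 ≤ r) (hrn : 10 ^ 4 * r ≤ n) (hrℓ : r ≤ ℓ) (hℓs : ℓ ≤ s)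
    (hsm : s ≤ m) (hmσ : m ≤ √(r * n)) (hΓ : 1 ≤ Γ)
    (hν : ∀ a : ℝ, (μ n).real {k : ℤ | (k : ℝ) ∈ Set.Ioc a (a + m)} ≤ Γ * m / n) (a : ℝ) :
    |(μ n).real {k : ℤ | (k : ℝ) ∈ Set.Ioc (a + s) (a + s + ℓ)} -
      (μ n).real {k : ℤ | (k : ℝ) ∈ Set.Ioc a (a + ℓ)}| ≤
    Γ * (10 ^ 13 * (m / √(r * n) + r / ℓ + n / ℓ * Real.exp (-(n / (1024 * r))))) * (ℓ / n) := by
  have hr0 : 0 < r := by linarith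
  have hℓ0 : 0 < ℓ := hr0.trans_le hrℓ
  have hm0 : 0 < m := by linarith
  have hn0 : (0 : ℝ) < n := by linarith
  set σ := √(r * n) with hσdef
  have hσ0 : 0 < σ := Real.sqrt_pos.2 (by positivity)
  have hσsq : σ ^ 2 = r * n := Real.sq_sqrt (by positivity)
  set R := ⌊r⌋₊
  have hRr : (R : ℝ) ≤ r := Nat.floor_le hr0.le
  have hR8 : 8 ≤ R := Nat.le_floor (by push_cast; linarith)
  have hrR : r ≤ 2 * R := by linarith [Nat.lt_floor_add_one r]
  have hR0 : (0 : ℝ) < R := by linarith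
  set K := ⌊n / (6144 * r)⌋₊
  have hKle : (K : ℝ) ≤ n / (6144 * r) := Nat.floor_le (by positivity)
  have hKle' : 6144 * r * K ≤ n := by
    rw [le_div_iff₀ (by positivity)] at hKle; linarith
  have hK1 : 1 ≤ K := Nat.le_floor (by
    rw [Nat.cast_one, one_le_div (by positivity)]; linarith)
  have hK2 : n / (6144 * r) ≤ 2 * K + 1 := by
    have := Nat.lt_floor_add_one (n / (6144 * r))
    have : (0 : ℝ) ≤ K := by positivity
    linarith
  have hσK : 864 * K * (R / 8 : ℝ) ^ 2 ≤ σ ^ 2 := by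
    rw [hσsq]
    calc 864 * K * (R / 8 : ℝ) ^ 2 ≤ 864 * K * (r / 8) ^ 2 := by gcongr
      _ = 864 / (64 * 6144) * r * (6144 * r * K) := by ring
      _ ≤ 864 / (64 * 6144) * r * n := by gcongr
      _ ≤ r * n := by nlinarith [mul_pos hr0 hn0]
  have hRσ : 24 * (R / 8 : ℝ) ≤ σ := Real.le_sqrt_of_sq_le (by nlinarith)
  have key := hμ.abs_real_Ioc_sub_le hR8 hK1 hσK hσ0 (by linarith) hℓs (hsm.trans hmσ) hRσ hm0 hmσ
    (κ := Γ / n) (fun a => (hν a).trans_eq (by ring)) a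
  refine key.trans ?_
  have h1 : 10 ^ 5 / √(2 * K + 1) ≤ 10 ^ 7 * (r / σ) := by
    have h2 : σ / r / 100 ≤ √(2 * K + 1) := by
      refine Real.le_sqrt_of_sq_le (le_trans ?_ hK2)
      rw [div_pow, div_pow, hσsq, div_div, div_le_div_iff₀ (by positivity) (by positivity)]
      nlinarith [mul_pos (mul_pos hr0 hn0) hr0]
    refine (div_le_div_of_nonneg_left (by norm_num) (by positivity) h2).trans_eq ?_
    field_simp
    norm_num
  have h2 : 10 ^ 5 * (ℓ * s) / ((R / 8 : ℝ) ^ 2 * (2 * K + 1)) ≤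
      16 * 10 ^ 10 * (ℓ * m / σ ^ 2) := by
    have h3 : σ ^ 2 / (256 * 6144) ≤ (R / 8 : ℝ) ^ 2 * (2 * K + 1) := by
      calc σ ^ 2 / (256 * 6144) = (r / 16) ^ 2 * (n / (6144 * r)) := by
            rw [hσsq]; field_simp; norm_num
        _ ≤ _ := by gcongr ?_ ^ 2 * ?_; linarith
    refine (div_le_div₀ (by positivity) (mul_le_mul_of_nonneg_left
      (mul_le_mul_of_nonneg_left hsm hℓ0.le) (by norm_num)) (by positivity) h3).trans ?_
    have : 0 < ℓ * m / σ ^ 2 := by positivity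
    calc 10 ^ 5 * (ℓ * m) / (σ ^ 2 / (256 * 6144))
        = 10 ^ 5 * (256 * 6144) * (ℓ * m / σ ^ 2) := by field_simp
      _ ≤ _ := by linarith
  have h3 := two_pow_mul_gainFactor_le (K := K) hr0 (by omega) hRr
    (by exact_mod_cast (by linarith : (R : ℝ) ≤ n)) hKle'
  set E := Real.exp (-(n / (1024 * r)))
  have hE : 0 < E := Real.exp_pos _
  have hπ := Real.pi_le_four
  calc _ ≤ 2 * (10 ^ 7 * (r / σ) + 16 * 10 ^ 10 * (ℓ * m / σ ^ 2)) *
          (4 * 4 * (Γ / n) * σ) + E := by gcongr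
    _ = Γ * (32 * 10 ^ 7 * (r / ℓ) + 32 * 16 * 10 ^ 10 * (m / σ)) * (ℓ / n) + E := by
        field_simp; ring
    _ ≤ Γ * (32 * 10 ^ 7 * (r / ℓ) + 32 * 16 * 10 ^ 10 * (m / σ)) * (ℓ / n) + Γ * E := by
        gcongr; exact le_mul_of_one_le_left hE.le hΓ
    _ = Γ * (32 * 10 ^ 7 * (r / ℓ) + 32 * 16 * 10 ^ 10 * (m / σ) + n / ℓ * E) * (ℓ / n) := by
        field_simp
    _ ≤ _ := by
        have h4 : 0 < r / ℓ := by positivity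
        have h5 : 0 < m / σ := by positivity
        have h6 : 0 < n / ℓ * E := by positivity
        gcongr
        linarith

lemma real_Ioc_add_mul (ν : Measure ℤ) [IsFiniteMeasure ν] {ℓ : ℝ} (hℓ : 0 ≤ ℓ) (a : ℝ) (k : ℕ) :
    ν.real {j : ℤ | (j : ℝ) ∈ Set.Ioc a (a + k * ℓ)} =
      ∑ i ∈ Finset.range k, ν.real {j : ℤ | (j : ℝ) ∈ Set.Ioc (a + i * ℓ) (a + i * ℓ + ℓ)} := by
  induction k with
  | zero => simp
  | succ k ih =>
    rw [Finset.sum_range_succ, ← ih, ← measureReal_union _ MeasurableSet.of_discrete]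
    · congr 1
      have h := Set.Ioc_union_Ioc_eq_Ioc (a := a) (b := a + k * ℓ) (c := a + k * ℓ + ℓ)
        (le_add_of_nonneg_right (by positivity)) (le_add_of_nonneg_right hℓ)
      ext j
      rw [show a + (k + 1 : ℕ) * ℓ = a + k * ℓ + ℓ by push_cast; ring, ← h]
      rfl
    · exact Set.disjoint_left.2 fun j hj hj' => hj.2.not_gt hj'.1

/-- If an interval is cut into `k` pieces of nearly equal mass, the first piece carries nearly the
fraction `1 / k` of the mass. -/
lemma abs_mul_real_Ioc_sub_le (ν : Measure ℤ) [IsFiniteMeasure ν] {ℓ δ : ℝ} (hℓ : 0 ≤ ℓ)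
    (hδ : 0 ≤ δ) (k : ℕ) (a : ℝ)
    (h : ∀ i : ℕ, 1 ≤ i → i < k →
      |ν.real {j : ℤ | (j : ℝ) ∈ Set.Ioc (a + i * ℓ) (a + i * ℓ + ℓ)} -
        ν.real {j : ℤ | (j : ℝ) ∈ Set.Ioc a (a + ℓ)}| ≤ δ) :
    |ν.real {j : ℤ | (j : ℝ) ∈ Set.Ioc a (a + k * ℓ)} -
      k * ν.real {j : ℤ | (j : ℝ) ∈ Set.Ioc a (a + ℓ)}| ≤ k * δ := by
  have h0 : k * ν.real {j : ℤ | (j : ℝ) ∈ Set.Ioc a (a + ℓ)} =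
      ∑ _i ∈ Finset.range k, ν.real {j : ℤ | (j : ℝ) ∈ Set.Ioc a (a + ℓ)} := by simp
  rw [real_Ioc_add_mul ν hℓ, h0, ← Finset.sum_sub_distrib]
  refine (Finset.abs_sum_le_sum_abs _ _).trans ?_
  refine (Finset.sum_le_card_nsmul _ _ δ fun i hi => ?_).trans (by simp)
  rcases Nat.eq_zero_or_pos i with rfl | hi'
  · simpa using hδ
  · exact h i hi' (Finset.mem_range.1 hi)

/-- **The core smoothing lemma.**  There are positive constants `c, C', C, r₀` such that:
if `S(n, m, ε, Γ)` holds, `ℓ` divides `m`, and there are `r` and `λ ≥ 1` with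
`r₀ ≤ r ≤ cn`, `m ≥ ℓ ≥ C'r` and `λm ≤ √(rn)`, then `S(n, ℓ, ε', Γ')` holds for every
`ε' ≥ ε + Γη` and `Γ' ≥ Γ(1 + η)`, where
`η = C(e^{−cλ²} + λm/√(rn) + r/ℓ + (n/ℓ)e^{−cn/r})`. -/
theorem core_smoothing
    (μ : ℕ → Measure ℤ) (hμ : IsQuicksortLaw μ) :
    ∃ c C' C r₀ : ℝ, 0 < c ∧ 0 < C' ∧ 0 < C ∧ 0 < r₀ ∧
      ∀ (f : ℝ → ℝ) (n : ℕ), 1 ≤ n → ∀ m ε Γ ℓ : ℝ,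
        0 < m → 0 < ε → 1 ≤ Γ → 0 < ℓ → (∃ k : ℕ, m = (k : ℝ) * ℓ) →
        Sprop (μ n) (meanZ (μ n)) n f m ε Γ →
        ∀ r lam : ℝ, 1 ≤ lam → r₀ ≤ r → r ≤ c * n → ℓ ≤ m → C' * r ≤ ℓ →
          lam * m ≤ Real.sqrt (r * n) →
        ∀ ε' Γ' : ℝ,
          ε + Γ * (C * (Real.exp (-c * lam ^ 2) + lam * m / Real.sqrt (r * n)
              + r / ℓ + ((n : ℝ) / ℓ) * Real.exp (-c * n / r))) ≤ ε' →
          Γ * (1 + C * (Real.exp (-c * lam ^ 2) + lam * m / Real.sqrt (r * n)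
              + r / ℓ + ((n : ℝ) / ℓ) * Real.exp (-c * n / r))) ≤ Γ' →
          Sprop (μ n) (meanZ (μ n)) n f ℓ ε' Γ' := by
  refine ⟨1 / 10 ^ 4, 1, 10 ^ 13, 16, by norm_num, by norm_num, by norm_num, by norm_num, ?_⟩
  rintro f n - m ε Γ ℓ hm - hΓ hℓ ⟨k, rfl⟩ ⟨hS1, hS2⟩ r lam hlam hr hrn hℓm hrℓ hσ ε' Γ' hε' hΓ'
  have := hμ.1 n
  have hr0 : 0 < r := by linarith
  have hn : (0 : ℝ) < n := by linarith
  have hk : (0 : ℝ) < k := pos_of_mul_pos_left hm hℓ.le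
  have hσ0 : 0 < √(r * n) := Real.sqrt_pos.2 (by positivity)
  have hmlam : k * ℓ ≤ lam * (k * ℓ) := le_mul_of_one_le_left hm.le hlam
  set η := 10 ^ 13 * (Real.exp (-(1 / 10 ^ 4) * lam ^ 2) + lam * (k * ℓ) / √(r * n) + r / ℓ +
    n / ℓ * Real.exp (-(1 / 10 ^ 4) * n / r)) with hη
  have hη0 : 0 ≤ η := by positivity
  have hδ0 : 0 ≤ Γ * η * (ℓ / n) := by positivity
  have hη' : 10 ^ 13 * (k * ℓ / √(r * n) + r / ℓ + n / ℓ * Real.exp (-(n / (1024 * r)))) ≤ η := by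
    have h1 : Real.exp (-(n / (1024 * r))) ≤ Real.exp (-(1 / 10 ^ 4) * n / r) := by
      refine Real.exp_le_exp.2 ?_
      have h2 : -(n / (1024 * r)) = -(1 / 1024) * (n / r) := by field_simp
      have h3 : 0 < n / r := by positivity
      rw [h2, mul_div_assoc]
      linarith
    have h2 : k * ℓ / √(r * n) ≤ lam * (k * ℓ) / √(r * n) := by gcongr
    have h3 := mul_le_mul_of_nonneg_left h1 (div_pos hn hℓ).le
    have := Real.exp_pos (-(1 / 10 ^ 4) * lam ^ 2)
    rw [hη]
    linarith
  have hpieces : ∀ a, |(μ n).real {j : ℤ | (j : ℝ) ∈ Set.Ioc a (a + k * ℓ)} -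
      k * (μ n).real {j : ℤ | (j : ℝ) ∈ Set.Ioc a (a + ℓ)}| ≤ k * (Γ * η * (ℓ / n)) := by
    refine fun a => abs_mul_real_Ioc_sub_le (μ n) hℓ.le hδ0 k a fun i hi hik => ?_
    have hi' : (1 : ℝ) ≤ i := by exact_mod_cast hi
    have hik' : (i : ℝ) ≤ k := by exact_mod_cast hik.le
    refine (hμ.abs_real_Ioc_sub_le_of_scale hr (by linarith) (by linarith)
      (le_mul_of_one_le_left hℓ.le hi') (mul_le_mul_of_nonneg_right hik' hℓ.le)
      (hmlam.trans hσ) hΓ hS2 a).trans ?_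
    gcongr
  refine ⟨fun a x hx => ?_, fun a => ?_⟩
  · have h1 := hS1 a x ⟨hx.1, hx.2.trans (by linarith)⟩
    have h2 := hpieces a
    change |(μ n).real _ - _| ≤ _ at h1
    change |(μ n).real _ - _| ≤ _
    refine le_of_mul_le_mul_left ?_ hk
    calc _ = |k * ((μ n).real {j : ℤ | (j : ℝ) ∈ Set.Ioc a (a + ℓ)} - ℓ / n * f x)| := by
          rw [abs_mul, abs_of_pos hk]
      _ = |((μ n).real {j : ℤ | (j : ℝ) ∈ Set.Ioc a (a + k * ℓ)} - k * ℓ / n * f x) -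
            ((μ n).real {j : ℤ | (j : ℝ) ∈ Set.Ioc a (a + k * ℓ)} -
              k * (μ n).real {j : ℤ | (j : ℝ) ∈ Set.Ioc a (a + ℓ)})| := by congr 1; ring
      _ ≤ ε * (k * ℓ) / n + k * (Γ * η * (ℓ / n)) := (abs_sub _ _).trans (add_le_add h1 h2)
      _ = k * ((ε + Γ * η) * ℓ / n) := by ring
      _ ≤ k * (ε' * ℓ / n) := by gcongr
  · have h1 := hS2 a
    have h2 := (abs_le.1 (hpieces a)).1
    change (μ n).real _ ≤ _ at h1
    change (μ n).real _ ≤ _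
    refine le_of_mul_le_mul_left ?_ hk
    calc _ ≤ Γ * (k * ℓ) / n + k * (Γ * η * (ℓ / n)) := by linarith
      _ = k * ((Γ * (1 + η)) * ℓ / n) := by ring
      _ ≤ k * (Γ' * ℓ / n) := by gcongr
end

section
/- There exist constants c > 0 and n_0 such that for every integer n ≥ n_0 there exist, on some probability space, a random variable Q with law μ_n and independent random variables A and B, with B having the binomial distribution Bi(⌈c n⌉, 2/3), such that P(Q = A + B) ≥ 1 − e^{−c n}. -/
open MeasureTheory ProbabilityTheory

/-- The binomial distribution `Bi(N, p)`, as a measure on `ℤ`. -/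
noncomputable def binomZ (N : ℕ) (p : ℝ) : Measure ℤ :=
  ∑ k ∈ Finset.range (N + 1),
    (ENNReal.ofReal ((N.choose k : ℝ) * p ^ k * (1 - p) ^ (N - k))) • Measure.dirac (k : ℤ)

open scoped NNReal ENNReal Polynomial

/-- The measure on `ℤ` whose probability generating function is the given polynomial. -/
noncomputable def genMeasure : ℝ≥0[X] →ₗ[ℝ≥0] Measure ℤ :=
  Polynomial.lsum fun k => LinearMap.toSpanSingleton ℝ≥0 (Measure ℤ) (Measure.dirac (k : ℤ))

lemma genMeasure_monomial (k : ℕ) (c : ℝ≥0) :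
    genMeasure (Polynomial.monomial k c) = c • Measure.dirac (k : ℤ) := by
  simp [genMeasure, Polynomial.lsum_apply]

lemma genMeasure_one : genMeasure 1 = Measure.dirac 0 := by
  simpa using genMeasure_monomial 0 1

lemma genMeasure_univ (p : ℝ≥0[X]) : genMeasure p Set.univ = (p.eval 1 : ℝ≥0) := by
  induction p using Polynomial.induction_on' with
  | add p q hp hq => simp [hp, hq]
  | monomial k c =>
    rw [genMeasure_monomial, Measure.smul_apply, measure_univ, Polynomial.eval_monomial, one_pow,
      ENNReal.smul_def, smul_eq_mul, mul_one, mul_one]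

instance (p : ℝ≥0[X]) : IsFiniteMeasure (genMeasure p) :=
  ⟨by rw [genMeasure_univ]; exact ENNReal.coe_lt_top⟩

lemma mconvZ_eq_conv (μ ν : Measure ℤ) [SFinite ν] : mconvZ μ ν = μ.conv ν := by
  ext s hs
  rw [mconvZ, Measure.bind_apply hs (Measurable.of_discrete.aemeasurable), Measure.conv,
    Measure.map_apply measurable_add hs, Measure.prod_apply (measurable_add hs)]
  refine lintegral_congr fun x => ?_
  rw [Measure.map_apply .of_discrete hs]
  rfl

lemma genMeasure_mul (p q : ℝ≥0[X]) :
    genMeasure (p * q) = (genMeasure p).conv (genMeasure q) := by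
  induction p using Polynomial.induction_on' with
  | add p₁ p₂ h₁ h₂ => rw [add_mul, map_add, map_add, h₁, h₂, Measure.add_conv]
  | monomial k c =>
    induction q using Polynomial.induction_on' with
    | add q₁ q₂ h₁ h₂ => rw [mul_add, map_add, map_add, h₁, h₂, Measure.conv_add]
    | monomial l d =>
      rw [Polynomial.monomial_mul_monomial]
      simp only [genMeasure_monomial, ENNReal.smul_def, Measure.conv_smul_left,
        Measure.conv_smul_right]
      rw [Measure.dirac_conv, Measure.map_dirac' .of_discrete, smul_smul, ENNReal.coe_mul,
        Nat.cast_add, mul_comm (d : ℝ≥0∞)]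

lemma genMeasure_mul_X_pow (p : ℝ≥0[X]) (k : ℕ) :
    genMeasure (p * Polynomial.X ^ k) = (genMeasure p).map (fun x => x + (k : ℤ)) := by
  rw [genMeasure_mul, Polynomial.X_pow_eq_monomial, genMeasure_monomial, one_smul,
    Measure.conv_dirac]

/-- The generating polynomial of the Bernoulli law with parameter `2/3`. -/
noncomputable def bernoulliPoly : ℝ≥0[X] :=
  Polynomial.C (2 / 3) * Polynomial.X + Polynomial.C (1 / 3)

lemma eval_one_bernoulliPoly : bernoulliPoly.eval 1 = 1 := by
  simp only [bernoulliPoly, Polynomial.eval_add, Polynomial.eval_mul, Polynomial.eval_C,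
    Polynomial.eval_X]
  rw [← NNReal.coe_inj]
  norm_num

lemma genMeasure_bernoulliPoly_pow (m : ℕ) :
    genMeasure (bernoulliPoly ^ m) = binomZ m (2 / 3) := by
  rw [bernoulliPoly, add_pow, map_sum, binomZ]
  refine Finset.sum_congr rfl fun k _ => ?_
  have h : (Polynomial.C (2 / 3 : ℝ≥0) * Polynomial.X) ^ k * Polynomial.C (1 / 3) ^ (m - k)
      * (m.choose k : ℝ≥0[X])
      = Polynomial.monomial k ((m.choose k : ℝ≥0) * (2 / 3) ^ k * (1 / 3) ^ (m - k)) := by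
    rw [← Polynomial.C_mul_X_pow_eq_monomial, ← Polynomial.C_eq_natCast]
    simp only [map_mul, map_pow]
    ring
  rw [h, genMeasure_monomial, ENNReal.smul_def]
  congr 1
  rw [ENNReal.ofReal, ENNReal.coe_inj, ← NNReal.coe_inj, Real.coe_toNNReal _ (by positivity)]
  push_cast
  norm_num

lemma IsQuicksortLaw.genMeasure_step {μ : ℕ → Measure ℤ} (hμ : IsQuicksortLaw μ) {n : ℕ}
    (hn : 2 ≤ n) (p : ℕ → ℝ≥0[X]) (hp : ∀ j < n, genMeasure (p j) = μ j) :
    genMeasure (Polynomial.C (n : ℝ≥0)⁻¹ *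
      ∑ u ∈ Finset.Icc 1 n, p (u - 1) * p (n - u) * Polynomial.X ^ (n - 1)) = μ n := by
  have := hμ.1
  rw [hμ.2.2.2 n hn, ← Polynomial.smul_eq_C_mul, map_smul, map_sum, ENNReal.smul_def,
    ENNReal.coe_inv (by positivity), ENNReal.coe_natCast]
  congr 1
  refine Finset.sum_congr rfl fun u hu => ?_
  rw [Finset.mem_Icc] at hu
  rw [genMeasure_mul_X_pow, genMeasure_mul, hp _ (by omega), hp _ (by omega), mconvZ_eq_conv,
    Nat.cast_sub (by omega), Nat.cast_one]

/-- An upper bound for `E[2 ^ (-N)]`, where `N` is the number of recursive calls of QuickSort on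
exactly three keys when it sorts `n` keys. -/
noncomputable def callBound (n : ℕ) : ℝ≥0 :=
  if n ≤ 2 then 1 else if n = 3 then 1 / 2 else (99 / 100) ^ (n + 1)

lemma callBound_le {n : ℕ} (hn : 3 ≤ n) : callBound n ≤ (99 / 100) ^ (n + 1) := by
  rw [callBound, if_neg (by omega)]
  split_ifs with h
  · rw [h, ← NNReal.coe_le_coe]
    norm_num
  · exact le_rfl

lemma sum_callBound_le {n : ℕ} (hn : 4 ≤ n) :
    (n : ℝ≥0)⁻¹ * ∑ j ∈ Finset.range n, callBound j * callBound (n - 1 - j) ≤ callBound n := by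
  rw [inv_mul_le_iff₀ (by positivity), ← NNReal.coe_le_coe]
  obtain h8 | h8 := lt_or_ge n 8
  · interval_cases n <;> norm_num [Finset.sum_range_succ, callBound]
  let ρ : ℝ := 99 / 100
  let e : ℕ → ℝ := fun j => if j < 4 then (callBound j : ℝ) / ρ ^ (j + 1) - 1 else 0
  have hb : ∀ j, (callBound j : ℝ) = ρ ^ (j + 1) * (1 + e j) := by
    intro j
    by_cases hj : j < 4
    · simp only [e, if_pos hj, ρ]
      field_simp
      ring
    · simp only [e, if_neg hj, callBound, if_neg (show ¬ j ≤ 2 by omega),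
        if_neg (show j ≠ 3 by omega), ρ]
      push_cast
      ring
  have he : ∀ j, 4 ≤ j → e j = 0 := fun j hj => if_neg (by omega)
  have hsum : ∑ j ∈ Finset.range n, e j ≤ 0 := by
    rw [← Finset.sum_subset (Finset.range_subset_range.2 (show 4 ≤ n by omega))
      (fun j _ hj => he j (by simpa using hj))]
    norm_num [Finset.sum_range_succ, e, callBound, ρ]
  have hterm : ∀ j ∈ Finset.range n, (callBound j * callBound (n - 1 - j) : ℝ)
      = ρ ^ (n + 1) * (1 + e j + e (n - 1 - j)) := by
    intro j hj
    rw [Finset.mem_range] at hj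
    rw [hb j, hb (n - 1 - j), show n + 1 = (j + 1) + (n - 1 - j + 1) by omega, pow_add]
    obtain h | h := le_or_gt 4 j
    · rw [he j h]; ring
    · rw [he (n - 1 - j) (by omega)]; ring
  push_cast
  rw [Finset.sum_congr rfl hterm, ← Finset.mul_sum, Finset.sum_add_distrib,
    Finset.sum_add_distrib, Finset.sum_range_reflect e n, hb n, he n (by omega)]
  simp only [Finset.sum_const, Finset.card_range, nsmul_eq_mul, mul_one, add_zero]
  have : 0 < ρ ^ (n + 1) := by positivity
  nlinarith

/-- The total mass of a bivariate generating polynomial, discounted by a factor `1/2` for each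
power of the outer variable. -/
noncomputable def halfWeight : ℝ≥0[X][X] →+* ℝ≥0 :=
  Polynomial.eval₂RingHom (Polynomial.evalRingHom 1) (1 / 2)

lemma halfWeight_C (p : ℝ≥0[X]) : halfWeight (Polynomial.C p) = p.eval 1 := by
  simp [halfWeight]

/-- QuickSort on three keys makes `2 + Bi(1, 2/3)` comparisons. The coefficient of degree `k` of
the outer variable collects the runs with `k` calls on three keys, whose own costs are
recovered by evaluating that variable at `bernoulliPoly`. -/
lemma IsQuicksortLaw.exists_poly {μ : ℕ → Measure ℤ} (hμ : IsQuicksortLaw μ) (n : ℕ) :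
    ∃ P : ℝ≥0[X][X], genMeasure (P.eval bernoulliPoly) = μ n ∧ halfWeight P ≤ callBound n := by
  have h₁ : ∀ j < 2, genMeasure 1 = μ j := by
    intro j hj
    interval_cases j
    · rw [genMeasure_one, hμ.2.1]
    · rw [genMeasure_one, hμ.2.2.1]
  have h₂ : genMeasure Polynomial.X = μ 2 := by
    rw [← hμ.genMeasure_step le_rfl (fun _ => 1) h₁]
    congr 1
    simp only [mul_one, one_mul, Finset.sum_const, Nat.card_Icc]
    norm_num
    rw [← mul_assoc, ← Polynomial.C_ofNat, ← Polynomial.C_mul]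
    norm_num
  induction n using Nat.strong_induction_on with
  | _ n ih =>
  obtain hn | rfl | rfl | hn : n < 2 ∨ n = 2 ∨ n = 3 ∨ 4 ≤ n := by omega
  · exact ⟨1, by rw [Polynomial.eval_one, h₁ n hn],
      by rw [map_one, callBound, if_pos (by omega)]⟩
  · exact ⟨Polynomial.C Polynomial.X, by rw [Polynomial.eval_C, h₂],
      by simp [halfWeight_C, callBound]⟩
  · refine ⟨Polynomial.C (Polynomial.X ^ 2) * Polynomial.X, ?_,
      by rw [map_mul, halfWeight_C]; simp [halfWeight, callBound]⟩
    rw [← hμ.genMeasure_step (by norm_num) (fun j => if j < 2 then 1 else Polynomial.X) ?_]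
    · congr 1
      simp only [Polynomial.eval_mul, Polynomial.eval_C, Polynomial.eval_X, bernoulliPoly]
      norm_num [Finset.sum_Icc_succ_top]
      have : (Polynomial.C (2 / 3 : ℝ≥0)) = Polynomial.C (3⁻¹) * 2 := by
        rw [← Polynomial.C_ofNat, ← Polynomial.C_mul]
        congr 1
        rw [mul_comm, div_eq_mul_inv]
      rw [this, one_div]
      ring
    · intro j hj
      interval_cases j
      exacts [h₁ 0 (by norm_num), h₁ 1 (by norm_num), h₂]
  · choose! P hP hw using ih
    refine ⟨Polynomial.C (Polynomial.C (n : ℝ≥0)⁻¹) * ∑ u ∈ Finset.Icc 1 n,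
      P (u - 1) * P (n - u) * Polynomial.C (Polynomial.X ^ (n - 1)), ?_, ?_⟩
    · rw [← hμ.genMeasure_step (by omega) (fun j => (P j).eval bernoulliPoly) hP]
      simp [Polynomial.eval_finsetSum]
    · refine le_trans ?_ (sum_callBound_le hn)
      rw [map_mul, halfWeight_C, Polynomial.eval_C, map_sum, Finset.range_eq_Ico,
        Finset.sum_Ico_eq_sum_range, ← Finset.Ico_add_one_right_eq_Icc,
        Finset.sum_Ico_eq_sum_range]
      gcongr (n : ℝ≥0)⁻¹ * ?_
      refine Finset.sum_le_sum fun j hj => ?_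
      rw [Finset.mem_range] at hj
      rw [map_mul, map_mul, halfWeight_C, Polynomial.eval_pow, Polynomial.eval_X, one_pow,
        mul_one, show 1 + j - 1 = j by omega, show n - (1 + j) = n - 1 - j by omega,
        zero_add]
      exact mul_le_mul' (hw j (by omega)) (hw _ (by omega))

/-- A measure that equals a convolution `ν ∗ β` plus a remainder `r` is the law of a variable
that agrees with a sum of independent variables outside an event of probability `r(ℤ)`. -/
lemma exists_coupling_of_eq_conv_add {μ ν β r : Measure ℤ} [IsProbabilityMeasure μ]
    [IsProbabilityMeasure β] [IsFiniteMeasure ν] [IsFiniteMeasure r] (h : μ = ν.conv β + r) :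
    ∃ (Ω : Type) (_ : MeasurableSpace Ω) (P : Measure Ω), IsProbabilityMeasure P ∧
      ∃ Q A B : Ω → ℤ, Measurable Q ∧ Measurable A ∧ Measurable B ∧
        P.map Q = μ ∧ IndepFun A B P ∧ P.map B = β ∧
        1 - r Set.univ ≤ P {ω | Q ω = A ω + B ω} := by
  have hconv : ν.conv β Set.univ = ν Set.univ := by
    rw [Measure.conv, Measure.map_apply measurable_add .univ, Set.preimage_univ,
      ← Set.univ_prod_univ, Measure.prod_prod, measure_univ (μ := β), mul_one]
  have hmass : ν Set.univ + r Set.univ = 1 := by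
    rw [← measure_univ (μ := μ), h, Measure.add_apply, hconv]
  let P : Measure (ℤ × ℤ × ℤ) := (ν.prod β).map (fun x => (x.1, x.2, x.1 + x.2)) +
    (Measure.dirac 0).prod (β.prod r)
  have hQ : P.map (fun x => x.2.2) = μ := by
    rw [Measure.map_add _ _ .of_discrete, Measure.map_map .of_discrete .of_discrete, h]
    congr 1
    have := Measure.map_map (μ := (Measure.dirac (0 : ℤ)).prod (β.prod r)) (g := Prod.snd)
      (f := Prod.snd) .of_discrete .of_discrete
    rw [Measure.map_snd_prod, measure_univ, one_smul, Measure.map_snd_prod, measure_univ,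
      one_smul] at this
    exact this.symm
  have hAB : P.map (fun x => (x.1, x.2.1)) =
      (ν + r Set.univ • Measure.dirac 0).prod β := by
    rw [Measure.map_add _ _ .of_discrete, Measure.map_map .of_discrete .of_discrete,
      Measure.add_prod, Measure.prod_smul_left]
    congr 1
    · exact Measure.map_id
    · have := Measure.map_prod_map (Measure.dirac (0 : ℤ)) (β.prod r) (f := id) (g := Prod.fst)
        .of_discrete .of_discrete
      rw [Measure.map_id, Measure.map_fst_prod, Measure.prod_smul_right] at this
      exact this.symm
  have hm : (ν + r Set.univ • Measure.dirac 0 : Measure ℤ) Set.univ = 1 := by simp [hmass]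
  have hA : P.map (fun x => x.1) = ν + r Set.univ • Measure.dirac 0 := by
    have := Measure.map_map (μ := P) (g := Prod.fst) (f := fun x => (x.1, x.2.1))
      .of_discrete .of_discrete
    rw [hAB, Measure.map_fst_prod, measure_univ, one_smul] at this
    exact this.symm
  have hB : P.map (fun x => x.2.1) = β := by
    have := Measure.map_map (μ := P) (g := Prod.snd) (f := fun x => (x.1, x.2.1))
      .of_discrete .of_discrete
    rw [hAB, Measure.map_snd_prod, hm, one_smul] at this
    exact this.symm
  have hP : IsProbabilityMeasure P := by
    refine ⟨?_⟩
    rw [← measure_univ (μ := μ), ← hQ, Measure.map_apply .of_discrete .univ, Set.preimage_univ]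
  refine ⟨_, _, P, hP, fun x => x.2.2, fun x => x.1, fun x => x.2.1, .of_discrete, .of_discrete,
    .of_discrete, hQ, ?_, hB, ?_⟩
  · rw [indepFun_iff_map_prod_eq_prod_map_map Measurable.of_discrete.aemeasurable
      Measurable.of_discrete.aemeasurable, hA, hB, hAB]
  · refine tsub_le_iff_right.2 ?_
    rw [← hmass]
    gcongr
    refine le_trans ?_ (Measure.le_add_right le_rfl _)
    rw [Measure.map_apply .of_discrete .of_discrete]
    simp only [Set.preimage_ofPred_eq, Set.ofPred_true]
    rw [← Set.univ_prod_univ, Measure.prod_prod, measure_univ (μ := β), mul_one]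

lemma sum_coeff_mul_bernoulliPoly_eval_one_le (P : ℝ≥0[X][X]) {x : ℝ} :
    ((∑ k ∈ Finset.range ⌈x⌉₊, P.coeff k * bernoulliPoly ^ k).eval 1 : ℝ≥0) ≤
      Real.exp x * halfWeight P := by
  have hw : ∑ k ∈ Finset.range ⌈x⌉₊, (P.coeff k).eval 1 * (1 / 2) ^ k ≤ halfWeight P := by
    rw [halfWeight, Polynomial.coe_eval₂RingHom,
      Polynomial.eval₂_eq_sum_range' _ (n := ⌈x⌉₊ + (P.natDegree + 1)) (by omega),
      Finset.sum_range_add]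
    exact le_self_add
  refine le_trans ?_ (mul_le_mul_of_nonneg_left (NNReal.coe_le_coe.2 hw) (Real.exp_pos _).le)
  rw [Polynomial.eval_finsetSum]
  push_cast
  rw [Finset.mul_sum]
  refine Finset.sum_le_sum fun k hk => ?_
  have hk' : (k : ℝ) < x := Nat.lt_ceil.1 (Finset.mem_range.1 hk)
  have h2 : (2 : ℝ) ^ k ≤ Real.exp x := by
    calc (2 : ℝ) ^ k ≤ Real.exp 1 ^ k := by
          gcongr
          linarith [Real.add_one_le_exp 1]
      _ = Real.exp k := by rw [← Real.exp_nat_mul, mul_one]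
      _ ≤ Real.exp x := Real.exp_le_exp.2 hk'.le
  rw [Polynomial.eval_mul, Polynomial.eval_pow, eval_one_bernoulliPoly, one_pow, mul_one]
  have h1 : 1 ≤ Real.exp x * (1 / 2) ^ k := by
    rw [one_div, inv_pow, ← div_eq_mul_inv, le_div_iff₀ (by positivity), one_mul]
    exact h2
  calc (((P.coeff k).eval 1 : ℝ≥0) : ℝ) ≤ ((P.coeff k).eval 1 : ℝ≥0) * (Real.exp x * (1 / 2) ^ k) :=
        le_mul_of_one_le_right (NNReal.coe_nonneg _) h1
    _ = _ := by ring

/-- **Binomial decomposition of QuickSort.**  There are constants `c > 0` and `n₀` such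
that for every `n ≥ n₀` there are, on some probability space, a random variable `Q` with
law `μ_n` and independent random variables `A` and `B` with `B ∼ Bi(⌈cn⌉, 2/3)` such that
`P(Q = A + B) ≥ 1 − e^{−cn}`. -/
theorem quicksort_binomial_decomposition
    (μ : ℕ → Measure ℤ) (hμ : IsQuicksortLaw μ) :
    ∃ c : ℝ, 0 < c ∧ ∃ n₀ : ℕ, ∀ n : ℕ, n₀ ≤ n →
      ∃ (Ω : Type) (mΩ : MeasurableSpace Ω) (P : Measure Ω),
        IsProbabilityMeasure P ∧
        ∃ Q A B : Ω → ℤ,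
          Measurable[mΩ] Q ∧ Measurable[mΩ] A ∧ Measurable[mΩ] B ∧
          @Measure.map Ω ℤ mΩ _ Q P = μ n ∧
          @ProbabilityTheory.IndepFun Ω ℤ ℤ mΩ _ _ A B P ∧
          @Measure.map Ω ℤ mΩ _ B P = binomZ ⌈c * (n : ℝ)⌉₊ (2 / 3) ∧
          1 - ENNReal.ofReal (Real.exp (-c * (n : ℝ))) ≤ P {ω | Q ω = A ω + B ω} := by
  refine ⟨1 / 200, by norm_num, 3, fun n hn => ?_⟩
  obtain ⟨P, hP, hw⟩ := hμ.exists_poly n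
  have := hμ.1 n
  set m := ⌈(1 / 200 : ℝ) * n⌉₊ with hm
  set r := ∑ k ∈ Finset.range m, P.coeff k * bernoulliPoly ^ k with hr
  have hβ : IsProbabilityMeasure (binomZ m (2 / 3)) := by
    refine ⟨?_⟩
    rw [← genMeasure_bernoulliPoly_pow, genMeasure_univ, Polynomial.eval_pow,
      eval_one_bernoulliPoly, one_pow, ENNReal.coe_one]
  have hsplit : μ n = (genMeasure (∑ j ∈ Finset.range (P.natDegree + 1),
      P.coeff (m + j) * bernoulliPoly ^ j)).conv (binomZ m (2 / 3)) + genMeasure r := by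
    rw [← genMeasure_bernoulliPoly_pow, ← genMeasure_mul, ← map_add, ← hP,
      Polynomial.eval_eq_sum_range' (n := m + (P.natDegree + 1)) (by omega),
      Finset.sum_range_add, add_comm, Finset.sum_mul]
    congr 2
    exact Finset.sum_congr rfl fun j _ => by rw [pow_add]; ring
  obtain ⟨Ω, mΩ, P', hP', Q, A, B, hQ, hA, hB, hQμ, hAB, hBβ, hle⟩ :=
    exists_coupling_of_eq_conv_add hsplit
  refine ⟨Ω, mΩ, P', hP', Q, A, B, hQ, hA, hB, hQμ, hAB, hBβ, le_trans ?_ hle⟩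
  refine tsub_le_tsub_left ?_ 1
  rw [genMeasure_univ, ← ENNReal.ofReal_coe_nnreal]
  refine ENNReal.ofReal_le_ofReal ((sum_coeff_mul_bernoulliPoly_eval_one_le P).trans ?_)
  have hρ : (halfWeight P : ℝ) ≤ Real.exp (-(1 / 100) * n) := by
    calc (halfWeight P : ℝ) ≤ (99 / 100) ^ (n + 1) := by
          exact_mod_cast hw.trans (callBound_le hn)
      _ ≤ (99 / 100) ^ n := pow_le_pow_of_le_one (by norm_num) (by norm_num) n.le_succ
      _ ≤ Real.exp (-(1 / 100)) ^ n := by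
          gcongr
          linarith [Real.add_one_le_exp (-(1 / 100) : ℝ)]
      _ = Real.exp (-(1 / 100) * n) := by rw [← Real.exp_nat_mul, mul_comm]
  calc Real.exp (1 / 200 * n) * halfWeight P
      ≤ Real.exp (1 / 200 * n) * Real.exp (-(1 / 100) * n) := by gcongr
    _ = Real.exp (-(1 / 200) * n) := by rw [← Real.exp_add]; ring_nf
end

section
/- Let C > 0 and C̃ > 0 be constants and let f : ℝ → ℝ be a differentiable function with |f(x)| ≤ 16 and |f'(x)| ≤ C̃ for all x ∈ ℝ. Suppose that for every x ∈ ℝ and every integer n ≥ 1, |(F_n(x + δ_n/2) − F_n(x − δ_n/2))/δ_n − f(x)| ≤ C n^{−1/6}, where δ_n = 2C n^{−1/6} and F_n is the distribution function of (Q_n − q_n)/n. Then for all sufficiently large n, the statement S(n, 2C n^{5/6}, (C + C̃ C) n^{−1/6}, 17) holds (for Q_n, q_n, f). -/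
open MeasureTheory ProbabilityTheory

/-- The distribution function `F_n` of `(Q_n − q_n)/n`:  `F_n(x) = P(Q_n ≤ q_n + n x)`. -/
noncomputable def distFun (μn : Measure ℤ) (qn : ℝ) (n : ℕ) (x : ℝ) : ℝ :=
  (μn {k : ℤ | (k : ℝ) ≤ qn + (n : ℝ) * x}).toReal

/-- Probabilities of half-open intervals are increments of the distribution function. -/
theorem toReal_Ioc_eq_distFun_sub (ν : Measure ℤ) [IsProbabilityMeasure ν] (q a δ : ℝ) {n : ℕ}
    (hn : 1 ≤ n) (hδ : 0 ≤ δ) :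
    (ν {k : ℤ | (k : ℝ) ∈ Set.Ioc a (a + n * δ)}).toReal =
      distFun ν q n ((a - q) / n + δ / 2 + δ / 2) - distFun ν q n ((a - q) / n + δ / 2 - δ / 2) := by
  have hn' : (0 : ℝ) < n := by exact_mod_cast hn
  have hupper : q + n * ((a - q) / n + δ / 2 + δ / 2) = a + n * δ := by field_simp; ring
  have hlower : q + n * ((a - q) / n + δ / 2 - δ / 2) = a := by field_simp; ring
  have hsub : {k : ℤ | (k : ℝ) ≤ a} ⊆ {k : ℤ | (k : ℝ) ≤ a + n * δ} := fun k hk =>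
    hk.out.trans (le_add_of_nonneg_right (by positivity))
  have hdiff : {k : ℤ | (k : ℝ) ∈ Set.Ioc a (a + n * δ)} =
      {k : ℤ | (k : ℝ) ≤ a + n * δ} \ {k : ℤ | (k : ℝ) ≤ a} := by
    ext k
    simp [and_comm]
  rw [distFun, distFun, hupper, hlower, hdiff]
  exact measureReal_sdiff hsub (Set.to_countable _).measurableSet

/-- A symmetric difference quotient of the distribution function that is within `η` of `f`
yields the smoothness statement, provided that `f` is Lipschitz and bounded above. -/
theorem Sprop.of_distFun (ν : Measure ℤ) [IsProbabilityMeasure ν] (q : ℝ) {n : ℕ} (hn : 1 ≤ n)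
    {f : ℝ → ℝ} {δ η L B Γ : ℝ} (hδ : 0 < δ) (hL : 0 ≤ L)
    (hfL : ∀ x y, |f x - f y| ≤ L * |x - y|) (hfB : ∀ x, f x ≤ B) (hΓ : B + η ≤ Γ)
    (h : ∀ x, |(distFun ν q n (x + δ / 2) - distFun ν q n (x - δ / 2)) / δ - f x| ≤ η) :
    Sprop ν q n f (n * δ) (η + L * (δ / 2)) Γ := by
  have hn' : (0 : ℝ) < n := by exact_mod_cast hn
  have key (a : ℝ) : |(ν {k : ℤ | (k : ℝ) ∈ Set.Ioc a (a + n * δ)}).toReal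
      - δ * f ((a - q) / n + δ / 2)| ≤ η * δ := by
    rw [toReal_Ioc_eq_distFun_sub ν q a δ hn hδ.le]
    have := h ((a - q) / n + δ / 2)
    rwa [div_sub' hδ.ne', abs_div, abs_of_pos hδ, div_le_iff₀ hδ] at this
  have hm (c : ℝ) : c * (n * δ) / n = c * δ := by field_simp
  refine ⟨fun a x hx => ?_, fun a => ?_⟩
  · have hxy : |(a - q) / n + δ / 2 - x| ≤ δ / 2 := by
      have hlow : (a - q) / n ≤ x := by rw [div_le_iff₀ hn']; linarith [hx.1]
      have hupp : x ≤ (a - q) / n + δ := by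
        rw [← sub_le_iff_le_add, le_div_iff₀ hn']; linarith [hx.2]
      rw [abs_le]; constructor <;> linarith
    have hf : |δ * f ((a - q) / n + δ / 2) - δ * f x| ≤ δ * (L * (δ / 2)) := by
      rw [← mul_sub, abs_mul, abs_of_pos hδ]
      gcongr
      exact (hfL _ _).trans (by gcongr)
    rw [hm, mul_div_cancel_left₀ _ hn'.ne']
    calc _ ≤ _ := abs_sub_le _ (δ * f ((a - q) / n + δ / 2)) _
      _ ≤ η * δ + δ * (L * (δ / 2)) := add_le_add (key a) hf
      _ = _ := by ring
  · rw [hm]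
    have h₁ := (abs_le.1 (key a)).2
    have h₂ := mul_le_mul_of_nonneg_left (hfB ((a - q) / n + δ / 2)) hδ.le
    have h₃ := mul_le_mul_of_nonneg_right hΓ hδ.le
    linarith

/-- **The starting point for smoothing.**  If `f` is differentiable with `|f| ≤ 16` and
`|f'| ≤ C̃`, and the distribution functions `F_n` of `(Q_n − q_n)/n` satisfy
`|(F_n(x + δ_n/2) − F_n(x − δ_n/2))/δ_n − f(x)| ≤ C n^{−1/6}` with `δ_n = 2C n^{−1/6}`,
then for all sufficiently large `n` the statement `S(n, 2C n^{5/6}, (C + C̃C) n^{−1/6}, 17)`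
holds. -/
theorem smoothing_starting_point
    (μ : ℕ → Measure ℤ) (hμ : IsQuicksortLaw μ)
    (C Ct : ℝ) (hC : 0 < C) (hCt : 0 < Ct)
    (f : ℝ → ℝ) (hf : Differentiable ℝ f)
    (hfb : ∀ x : ℝ, |f x| ≤ 16) (hf'b : ∀ x : ℝ, |deriv f x| ≤ Ct)
    (hFn : ∀ (x : ℝ) (n : ℕ), 1 ≤ n →
      |(distFun (μ n) (meanZ (μ n)) n (x + (2 * C * (n : ℝ) ^ (-1 / 6 : ℝ)) / 2)
          - distFun (μ n) (meanZ (μ n)) n (x - (2 * C * (n : ℝ) ^ (-1 / 6 : ℝ)) / 2))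
          / (2 * C * (n : ℝ) ^ (-1 / 6 : ℝ)) - f x|
        ≤ C * (n : ℝ) ^ (-1 / 6 : ℝ)) :
    ∃ N : ℕ, ∀ n : ℕ, N ≤ n →
      Sprop (μ n) (meanZ (μ n)) n f (2 * C * (n : ℝ) ^ (5 / 6 : ℝ))
        ((C + Ct * C) * (n : ℝ) ^ (-1 / 6 : ℝ)) 17 := by
  have hlim : Filter.Tendsto (fun n : ℕ => C * (n : ℝ) ^ (-1 / 6 : ℝ)) Filter.atTop (nhds 0) := by
    have h := (tendsto_rpow_neg_atTop (y := 1 / 6) (by norm_num)).comp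
      (tendsto_natCast_atTop_atTop (R := ℝ))
    simpa [Function.comp_def, neg_div] using h.const_mul C
  obtain ⟨N, hN⟩ := Filter.eventually_atTop.1 (hlim.eventually_le_const one_pos)
  refine ⟨max N 1, fun n hn => ?_⟩
  have hn1 : 1 ≤ n := (le_max_right _ _).trans hn
  have hn0 : (0 : ℝ) < n := by exact_mod_cast hn1
  have := hμ.1 n
  have hlip (x y : ℝ) : |f x - f y| ≤ Ct * |x - y| :=
    convex_univ.norm_image_sub_le_of_norm_deriv_le (fun z _ => hf z) (fun z _ => hf'b z)
      (Set.mem_univ y) (Set.mem_univ x)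
  have hpow : (n : ℝ) ^ (5 / 6 : ℝ) = n * (n : ℝ) ^ (-1 / 6 : ℝ) := by
    rw [← Real.rpow_one_add' hn0.le (by norm_num)]
    norm_num
  convert Sprop.of_distFun (μ n) (meanZ (μ n)) hn1 (Γ := 17) (by positivity) hCt.le hlip
    (fun x => (abs_le.1 (hfb x)).2) (by linarith [hN n ((le_max_left _ _).trans hn)])
    (fun x => hFn x n hn1) using 1
  · rw [hpow]; ring
  · ring
end
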